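/- Let d ≥ 2, γ ∈ {0,1}, p, q ∈ (1,∞), r ∈ [p,∞), and suppose 2 − γ < β ≤ d/p + 2/q < 2 − γ + d/r. Then there is a constant N = N(d, p, q, r, β) such that for every u ∈ C^∞(ℝ^{d+1}) with ‖u‖_{E_{p,q,β}} + ‖Du‖_{E_{p,q,β}} + ‖D²u‖_{E_{p,q,β}} + ‖∂_t u‖_{E_{p,q,β}} < ∞, ‖D^γ u(0,·)‖_{E_{r,β+γ−2}(ℝ^d)} ≤ N (‖u‖_{E_{p,q,β}} + ‖Du‖_{E_{p,q,β}} + ‖D²u‖_{E_{p,q,β}} + ‖∂_t u‖_{E_{p,q,β}}). -/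

import Mathlib

open MeasureTheory ENNReal Metric Set

/-- The mixed norm `‖g‖_{L_{p,q}}^q = ∫_ℝ (∫_{ℝ^d} |g(t,x)|^p dx)^{q/p} dt`. -/
noncomputable def mixedNorm (d : ℕ) (p q : ℝ) (g : ℝ × EuclideanSpace ℝ (Fin d) → ℝ) : ℝ≥0∞ :=
  (∫⁻ t : ℝ, (∫⁻ x : EuclideanSpace ℝ (Fin d),
    (ENNReal.ofReal |g (t, x)|) ^ p) ^ (q / p)) ^ (1 / q)

/-- The parabolic cylinder `C_ρ(t,x) = [t, t+ρ²) × B_ρ(x)`. -/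
def cyl (d : ℕ) (ρ : ℝ) (z : ℝ × EuclideanSpace ℝ (Fin d)) :
    Set (ℝ × EuclideanSpace ℝ (Fin d)) :=
  Set.Ico z.1 (z.1 + ρ ^ 2) ×ˢ ball z.2 ρ

/-- The trace `D^γ u(0,·)` : `u(0,x)` if `γ = 0` and `|Du(0,x)|` if `γ = 1`. -/
noncomputable def traceD (d : ℕ) (γ : ℕ) (u : ℝ × EuclideanSpace ℝ (Fin d) → ℝ)
    (x : EuclideanSpace ℝ (Fin d)) : ℝ :=
  if γ = 1 then ‖fderiv ℝ (fun y => u (0, y)) x‖ else u (0, x)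

/-- The time derivative `∂_t u`. -/
noncomputable def timeDeriv (d : ℕ) (u : ℝ × EuclideanSpace ℝ (Fin d) → ℝ)
    (z : ℝ × EuclideanSpace ℝ (Fin d)) : ℝ :=
  deriv (fun s => u (s, z.2)) z.1

/-- The norm of the spatial gradient `|Du|`. -/
noncomputable def spaceGradNorm (d : ℕ) (u : ℝ × EuclideanSpace ℝ (Fin d) → ℝ)
    (z : ℝ × EuclideanSpace ℝ (Fin d)) : ℝ :=
  ‖fderiv ℝ (fun y => u (z.1, y)) z.2‖

/-- The norm of the spatial Hessian `|D²u|`. -/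
noncomputable def spaceHessNorm (d : ℕ) (u : ℝ × EuclideanSpace ℝ (Fin d) → ℝ)
    (z : ℝ × EuclideanSpace ℝ (Fin d)) : ℝ :=
  ‖fderiv ℝ (fun y => fderiv ℝ (fun w => u (z.1, w)) y) z.2‖

/-- Parabolic Morrey norm with radii ranging over `S`:
`sup_{ρ ∈ S} sup_{(t,x)} ρ^β ‖1_C‖_{L_{p,q}}⁻¹ ‖g 1_C‖_{L_{p,q}}` with `C = C_ρ(t,x)`. -/
noncomputable def pMorrey (d : ℕ) (S : Set ℝ) (p q β : ℝ)
    (g : ℝ × EuclideanSpace ℝ (Fin d) → ℝ) : ℝ≥0∞ :=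
  ⨆ (ρ : ℝ) (_ : ρ ∈ S), ⨆ z : ℝ × EuclideanSpace ℝ (Fin d),
    ENNReal.ofReal (ρ ^ β) * mixedNorm d p q ((cyl d ρ z).indicator g) /
      mixedNorm d p q ((cyl d ρ z).indicator fun _ => (1 : ℝ))

/-- Morrey norm on `ℝ^d` with radii ranging over `S`. -/
noncomputable def morreyNormOn (d : ℕ) (S : Set ℝ) (r β : ℝ)
    (f : EuclideanSpace ℝ (Fin d) → ℝ) : ℝ≥0∞ :=
  ⨆ (ρ : ℝ) (_ : ρ ∈ S), ⨆ x : EuclideanSpace ℝ (Fin d),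
    ENNReal.ofReal (ρ ^ β * (⨍ y in ball x ρ, |f y| ^ r) ^ (1 / r))

theorem lintegral_rpow_lintegral_le_aux {α S : Type*} [MeasurableSpace α] [MeasurableSpace S]
    {μ : Measure α} {ν : Measure S} [SFinite μ] [SFinite ν] {r : ℝ} (hr : 1 ≤ r)
    {h : S → α → ℝ≥0∞} (hh : Measurable (Function.uncurry h)) {w : S → ℝ≥0∞} (hw : Measurable w)
    (hw0 : ∀ s, w s ≠ 0) (hwt : ∀ᵐ s ∂ν, w s ≠ ∞)
    (hle : ∀ s, ∫⁻ x, h s x ^ r ∂μ ≤ w s ^ r) :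
    ∫⁻ x, (∫⁻ s, h s x ∂ν) ^ r ∂μ ≤ (∫⁻ s, w s ∂ν) ^ r := by
  have hr0 : 0 < r := by linarith
  have hhs : ∀ x, Measurable fun s => h s x := fun x =>
    hh.comp (measurable_id.prodMk measurable_const)
  have key : ∀ x, (∫⁻ s, h s x ∂ν) ^ r
      ≤ (∫⁻ s, w s ∂ν) ^ (r - 1) * ∫⁻ s, h s x ^ r * w s ^ (1 - r) ∂ν := by
    intro x
    have h1 : ∫⁻ s, h s x ∂ν
        = ∫⁻ s, w s ^ (1 - 1 / r) * (h s x ^ r * w s ^ (1 - r)) ^ (1 / r) ∂ν := by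
      refine lintegral_congr_ae (hwt.mono fun s hs => ?_)
      beta_reduce
      rw [ENNReal.mul_rpow_of_nonneg _ _ (by positivity), ← ENNReal.rpow_mul, ← ENNReal.rpow_mul,
        mul_one_div_cancel hr0.ne', ENNReal.rpow_one, mul_left_comm,
        ← ENNReal.rpow_add _ _ (hw0 s) hs]
      have : 1 - 1 / r + (1 - r) * (1 / r) = 0 := by field_simp; ring
      rw [this, ENNReal.rpow_zero, mul_one]
    have h2 := ENNReal.lintegral_mul_norm_pow_le (μ := ν) (f := w)
      (g := fun s => h s x ^ r * w s ^ (1 - r)) hw.aemeasurable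
      (((hhs x).pow_const r).mul (hw.pow_const _)).aemeasurable (p := 1 - 1 / r) (q := 1 / r)
      (by rw [sub_nonneg, div_le_one hr0]; exact hr) (by positivity) (by ring)
    calc _ ≤ ((∫⁻ s, w s ∂ν) ^ (1 - 1 / r) *
          (∫⁻ s, h s x ^ r * w s ^ (1 - r) ∂ν) ^ (1 / r)) ^ r := by
          rw [h1]; exact ENNReal.rpow_le_rpow h2 hr0.le
      _ = _ := by
          rw [ENNReal.mul_rpow_of_nonneg _ _ hr0.le, ← ENNReal.rpow_mul, ← ENNReal.rpow_mul,
            one_div_mul_cancel hr0.ne', ENNReal.rpow_one]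
          congr 2; field_simp
  calc _ ≤ ∫⁻ x, (∫⁻ s, w s ∂ν) ^ (r - 1) * ∫⁻ s, h s x ^ r * w s ^ (1 - r) ∂ν ∂μ :=
        lintegral_mono key
    _ = (∫⁻ s, w s ∂ν) ^ (r - 1) * ∫⁻ x, ∫⁻ s, h s x ^ r * w s ^ (1 - r) ∂ν ∂μ := by
        refine lintegral_const_mul _ (Measurable.lintegral_prod_right'
          (f := fun z : α × S => h z.2 z.1 ^ r * w z.2 ^ (1 - r)) ?_)
        exact ((hh.comp measurable_swap).pow_const _).mul ((hw.comp measurable_snd).pow_const _)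
    _ = (∫⁻ s, w s ∂ν) ^ (r - 1) * ∫⁻ s, ∫⁻ x, h s x ^ r * w s ^ (1 - r) ∂μ ∂ν := by
        rw [lintegral_lintegral_swap]
        exact (((hh.comp measurable_swap).pow_const _).mul
          ((hw.comp measurable_snd).pow_const _)).aemeasurable
    _ ≤ (∫⁻ s, w s ∂ν) ^ (r - 1) * ∫⁻ s, w s ∂ν := by
        refine mul_le_mul' le_rfl (lintegral_mono_ae (hwt.mono fun s hs => ?_))
        have hsm : Measurable fun x => h s x := hh.comp (measurable_const.prodMk measurable_id)
        rw [lintegral_mul_const _ (hsm.pow_const r)]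
        calc _ ≤ w s ^ r * w s ^ (1 - r) := by gcongr; exact hle s
          _ = w s := by rw [← ENNReal.rpow_add _ _ (hw0 s) hs]; simp
    _ = _ := by
        conv_lhs => rw [← ENNReal.rpow_one (∫⁻ s, w s ∂ν), ← ENNReal.rpow_mul, one_mul]
        rw [← ENNReal.rpow_add_of_nonneg _ _ (by linarith) zero_le_one]; simp

/-- Minkowski's integral inequality. -/
theorem lintegral_rpow_lintegral_le {α S : Type*} [MeasurableSpace α] [MeasurableSpace S]
    {μ : Measure α} {ν : Measure S} [SFinite μ] [SigmaFinite ν] {r : ℝ} (hr : 1 ≤ r)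
    {h : S → α → ℝ≥0∞} (hh : Measurable (Function.uncurry h)) :
    (∫⁻ x, (∫⁻ s, h s x ∂ν) ^ r ∂μ) ^ (1 / r) ≤ ∫⁻ s, (∫⁻ x, h s x ^ r ∂μ) ^ (1 / r) ∂ν := by
  have hr0 : 0 < r := by linarith
  have hwm : Measurable fun s => (∫⁻ x, h s x ^ r ∂μ) ^ (1 / r) :=
    (Measurable.lintegral_prod_right' (hh.pow_const r)).pow_const _
  refine ENNReal.le_of_forall_pos_le_add fun ε hε hfin => ?_
  obtain ⟨g, g0, gm, gi⟩ := exists_pos_lintegral_lt_of_sigmaFinite ν (ENNReal.coe_pos.2 hε).ne'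
  have := lintegral_rpow_lintegral_le_aux (μ := μ) (ν := ν) hr hh
    (w := fun s => (∫⁻ x, h s x ^ r ∂μ) ^ (1 / r) + g s) (hwm.add gm.coe_nnreal_ennreal)
    (fun s => by simp [(g0 s).ne'])
    ((ae_lt_top hwm hfin.ne).mono fun s hs => by simpa using hs.ne) (fun s => by
      calc _ = ((∫⁻ x, h s x ^ r ∂μ) ^ (1 / r)) ^ r := by
            rw [← ENNReal.rpow_mul, one_div_mul_cancel hr0.ne', ENNReal.rpow_one]
        _ ≤ _ := by gcongr; exact le_self_add)
  calc _ ≤ ((∫⁻ s, ((∫⁻ x, h s x ^ r ∂μ) ^ (1 / r) + g s) ∂ν) ^ r) ^ (1 / r) := by gcongr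
    _ = ∫⁻ s, ((∫⁻ x, h s x ^ r ∂μ) ^ (1 / r) + g s) ∂ν := by
        rw [← ENNReal.rpow_mul, mul_one_div_cancel hr0.ne', ENNReal.rpow_one]
    _ ≤ _ := by rw [lintegral_add_left hwm]; gcongr

theorem lintegral_comp_smul_haar {E : Type*} [NormedAddCommGroup E] [NormedSpace ℝ E]
    [MeasurableSpace E] [BorelSpace E] [FiniteDimensional ℝ E] (μ : Measure E)
    [μ.IsAddHaarMeasure] {e : ℝ} (he : 0 < e) (g : E → ℝ≥0∞) :
    ∫⁻ y, g (e • y) ∂μ = ENNReal.ofReal (e ^ (-(Module.finrank ℝ E : ℝ))) * ∫⁻ y, g y ∂μ := by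
  have hemb : MeasurableEmbedding fun y : E => e • y :=
    (Homeomorph.smulOfNeZero e he.ne').measurableEmbedding
  rw [← hemb.lintegral_map, Measure.map_addHaar_smul μ he.ne', lintegral_smul_measure,
    abs_of_pos (by positivity), Real.rpow_neg he.le, Real.rpow_natCast, smul_eq_mul]

theorem lintegral_unit_ball_comp {E : Type*} [NormedAddCommGroup E] [NormedSpace ℝ E]
    [MeasurableSpace E] [BorelSpace E] [FiniteDimensional ℝ E] (μ : Measure E)
    [μ.IsAddHaarMeasure] {e : ℝ} (he : 0 < e) (x : E) (g : E → ℝ≥0∞) :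
    ∫⁻ y in ball 0 1, g (x + e • y) ∂μ
      = ENNReal.ofReal (e ^ (-(Module.finrank ℝ E : ℝ))) * ∫⁻ y in ball x e, g y ∂μ := by
  rw [← lintegral_indicator measurableSet_ball, ← lintegral_indicator measurableSet_ball,
    ← lintegral_add_left_eq_self (μ := μ) ((ball x e).indicator g) x,
    ← lintegral_comp_smul_haar μ he]
  refine lintegral_congr fun y => ?_
  have : x + e • y ∈ ball x e ↔ y ∈ ball (0 : E) 1 := by
    simp [norm_smul, abs_of_pos he, he]
  by_cases hy : y ∈ ball (0 : E) 1
  · rw [indicator_of_mem hy, indicator_of_mem (this.2 hy)]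
  · rw [indicator_of_notMem hy, indicator_of_notMem (mt this.1 hy)]

theorem lintegral_Ioo_comp_sq_mul {e : ℝ} (he : 0 < e) (g : ℝ → ℝ≥0∞) :
    ∫⁻ s in Ioo 0 1, g (e ^ 2 * s)
      = ENNReal.ofReal (e ^ (-2 : ℝ)) * ∫⁻ t in Ico 0 (e ^ 2), g t := by
  rw [← setLIntegral_congr (Ioo_ae_eq_Ico (μ := volume) (a := (0 : ℝ)) (b := e ^ 2)),
    ← lintegral_indicator measurableSet_Ioo, ← lintegral_indicator measurableSet_Ioo]
  have h := lintegral_comp_smul_haar (volume : Measure ℝ) (e := e ^ 2) (by positivity)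
    ((Ioo 0 (e ^ 2)).indicator g)
  have h2 : (e ^ 2) ^ (-(Module.finrank ℝ ℝ : ℝ)) = e ^ (-2 : ℝ) := by
    simp [Real.rpow_neg he.le, Real.rpow_neg (sq_nonneg e)]
  rw [← h2, ← h]
  refine lintegral_congr fun y => ?_
  have : e ^ 2 * y ∈ Ioo 0 (e ^ 2) ↔ y ∈ Ioo (0 : ℝ) 1 := by
    have : 0 < e ^ 2 := by positivity
    simp only [mem_Ioo]
    constructor
    · rintro ⟨h1, h2⟩; constructor <;> nlinarith
    · rintro ⟨h1, h2⟩; constructor <;> nlinarith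
  by_cases hy : y ∈ Ioo (0 : ℝ) 1
  · rw [indicator_of_mem hy, smul_eq_mul, indicator_of_mem (this.2 hy)]
  · rw [indicator_of_notMem hy, smul_eq_mul, indicator_of_notMem (mt this.1 hy)]

/-- Jensen's inequality for a power of an average over a set of finite measure. -/
theorem lintegral_le_measure_rpow_mul {α : Type*} [MeasurableSpace α] (μ : Measure α)
    {p : ℝ} (hp : 1 ≤ p) {g : α → ℝ≥0∞} (hg : AEMeasurable g μ) :
    ∫⁻ x, g x ∂μ ≤ μ univ ^ (1 - 1 / p) * (∫⁻ x, g x ^ p ∂μ) ^ (1 / p) := by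
  have hp0 : 0 < p := by linarith
  have h2 := ENNReal.lintegral_mul_norm_pow_le (μ := μ) (f := fun _ => 1)
      (g := fun s => g s ^ p) aemeasurable_const (hg.pow_const _) (p := 1 - 1 / p) (q := 1 / p)
      (by rw [sub_nonneg, div_le_one hp0]; exact hp) (by positivity) (by ring)
  simpa [← ENNReal.rpow_mul, mul_inv_cancel₀ hp0.ne'] using h2

theorem measurable_sliceNorm {E : Type*} [NormedAddCommGroup E] [MeasurableSpace E] (μ : Measure E)
    [SFinite μ] {p : ℝ} {f : ℝ × E → ℝ≥0∞} (hf : Measurable f) (c : E) (R : ℝ) :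
    Measurable fun t : ℝ => ∫⁻ x in ball c R, f (t, x) ^ p ∂μ :=
  Measurable.lintegral_prod_right' (hf.pow_const p)

theorem lintegral_ball_add_le {E : Type*} [NormedAddCommGroup E] [MeasurableSpace E] [BorelSpace E]
    (μ : Measure E) [μ.IsAddRightInvariant] (g : E → ℝ≥0∞) {ρ : ℝ} (x₀ v : E) (hv : ‖v‖ ≤ ρ) :
    ∫⁻ x in ball x₀ ρ, g (x + v) ∂μ ≤ ∫⁻ x in ball x₀ (2 * ρ), g x ∂μ := by
  rw [← lintegral_indicator measurableSet_ball, ← lintegral_indicator measurableSet_ball,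
    ← lintegral_add_right_eq_self (μ := μ) ((ball x₀ (2 * ρ)).indicator g) v]
  refine lintegral_mono fun x => ?_
  by_cases hx : x ∈ ball x₀ ρ
  · have : x + v ∈ ball x₀ (2 * ρ) := by
      rw [mem_ball_iff_norm] at hx ⊢
      have : ‖x + v - x₀‖ ≤ ‖x - x₀‖ + ‖v‖ := by
        rw [show x + v - x₀ = (x - x₀) + v by abel]; exact norm_add_le _ _
      linarith
    simp [hx, this]
  · simp [hx]

section LocalEstimates

variable {E : Type*} [NormedAddCommGroup E] [NormedSpace ℝ E] [MeasurableSpace E] [BorelSpace E]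
  [FiniteDimensional ℝ E] (μ : Measure E) [μ.IsAddHaarMeasure]

/-- The mixed norm of `f` over the parabolic cylinder of radius `ρ` at `z`. -/
noncomputable def cylNorm (p q : ℝ) (f : ℝ × E → ℝ≥0∞) (ρ : ℝ) (z : ℝ × E) : ℝ≥0∞ :=
  (∫⁻ t in Ico z.1 (z.1 + ρ ^ 2), (∫⁻ x in ball z.2 ρ, f (t, x) ^ p ∂μ) ^ (q / p)) ^ (1 / q)

/-- The rescaled integral of `f` over the cylinder of radius `e` at `(0, x)`. -/
noncomputable def cylMean (f : ℝ × E → ℝ≥0∞) (e : ℝ) (x : E) : ℝ≥0∞ :=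
  ∫⁻ s in Ioo (0 : ℝ) 1, ∫⁻ y in ball (0 : E) 1, f (e ^ 2 * s, x + e • y) ∂μ

variable {p q r : ℝ} {f : ℝ × E → ℝ≥0∞}

theorem measurable_ballInt (hf : Measurable f) :
    Measurable fun w : ℝ × ℝ × E =>
      ∫⁻ y in ball (0 : E) 1, f (w.1 ^ 2 * w.2.1, w.2.2 + w.1 • y) ∂μ := by
  refine Measurable.lintegral_prod_right'
    (f := fun v : (ℝ × ℝ × E) × E => f (v.1.1 ^ 2 * v.1.2.1, v.1.2.2 + v.1.1 • v.2)) ?_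
  refine hf.comp (Continuous.measurable ?_)
  fun_prop

theorem measurable_cylMean (hf : Measurable f) :
    Measurable fun w : ℝ × E => cylMean μ f w.1 w.2 := by
  refine Measurable.lintegral_prod_right' (f := fun v : (ℝ × E) × ℝ =>
    ∫⁻ y in ball (0 : E) 1, f (v.1.1 ^ 2 * v.2, v.1.2 + v.1.1 • y) ∂μ) ?_
  exact (measurable_ballInt μ hf).comp (g := fun w : ℝ × ℝ × E =>
      ∫⁻ y in ball (0 : E) 1, f (w.1 ^ 2 * w.2.1, w.2.2 + w.1 • y) ∂μ)
    (measurable_fst.fst.prodMk (measurable_snd.prodMk measurable_fst.snd))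

theorem lintegral_sliceNorm_le (hp : 1 ≤ p) (hq : 1 ≤ q) (hf : Measurable f) {e R : ℝ}
    (he : 0 < e) (heR : e ≤ R) (c : E) :
    ∫⁻ s in Ioo (0 : ℝ) 1, (∫⁻ x in ball c R, f (e ^ 2 * s, x) ^ p ∂μ) ^ (1 / p)
      ≤ ENNReal.ofReal (e ^ (-(2 / q))) * cylNorm μ p q f R (0, c) := by
  have hp0 : 0 < p := by linarith
  have hq0 : 0 < q := by linarith
  have hm := measurable_sliceNorm (p := p) μ hf c R
  have h1 := lintegral_le_measure_rpow_mul (volume.restrict (Ioo (0 : ℝ) 1)) hq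
    (g := fun s => (∫⁻ x in ball c R, f (e ^ 2 * s, x) ^ p ∂μ) ^ (1 / p))
    (((hm.comp (measurable_const_mul (e ^ 2))).pow_const _).aemeasurable)
  simp only [Measure.restrict_apply_univ, Real.volume_Ioo, sub_zero, ENNReal.ofReal_one,
    ENNReal.one_rpow, one_mul, ← ENNReal.rpow_mul] at h1
  refine h1.trans ?_
  rw [lintegral_Ioo_comp_sq_mul he
    (fun t => (∫⁻ x in ball c R, f (t, x) ^ p ∂μ) ^ (1 / p * q)),
    ENNReal.mul_rpow_of_nonneg _ _ (by positivity),
    ENNReal.ofReal_rpow_of_nonneg (by positivity) (by positivity), ← Real.rpow_mul he.le]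
  refine mul_le_mul' (le_of_eq ?_) ?_
  · congr 2; ring
  · rw [cylNorm, zero_add, show 1 / p * q = q / p by ring]
    refine ENNReal.rpow_le_rpow (lintegral_mono_set (Ico_subset_Ico_right ?_)) (by positivity)
    gcongr

theorem cylMean_le_cylNorm (hp : 1 ≤ p) (hq : 1 ≤ q) (hf : Measurable f) {e : ℝ} (he : 0 < e)
    (x : E) :
    cylMean μ f e x ≤ μ (ball 0 1) ^ (1 - 1 / p) *
      (ENNReal.ofReal (e ^ (-(Module.finrank ℝ E / p + 2 / q))) * cylNorm μ p q f e (0, x)) := by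
  have hp0 : 0 < p := by linarith
  have hm := measurable_sliceNorm (p := p) μ hf x e
  have h1 : ∀ t, ∫⁻ y in ball (0 : E) 1, f (t, x + e • y) ∂μ
      ≤ μ (ball 0 1) ^ (1 - 1 / p) * (ENNReal.ofReal (e ^ (-(Module.finrank ℝ E / p)))
        * (∫⁻ y in ball x e, f (t, y) ^ p ∂μ) ^ (1 / p)) := by
    intro t
    have h2 := lintegral_le_measure_rpow_mul (μ.restrict (ball 0 1)) hp
      (g := fun y => f (t, x + e • y))
      (hf.comp (Continuous.measurable (by fun_prop))).aemeasurable
    rw [Measure.restrict_apply_univ, lintegral_unit_ball_comp μ he x (fun y => f (t, y) ^ p),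
      ENNReal.mul_rpow_of_nonneg _ _ (by positivity),
      ENNReal.ofReal_rpow_of_nonneg (by positivity) (by positivity), ← Real.rpow_mul he.le] at h2
    rwa [neg_mul, mul_one_div] at h2
  calc cylMean μ f e x ≤ ∫⁻ s in Ioo (0 : ℝ) 1, μ (ball 0 1) ^ (1 - 1 / p) *
        (ENNReal.ofReal (e ^ (-(Module.finrank ℝ E / p)))
        * (∫⁻ y in ball x e, f (e ^ 2 * s, y) ^ p ∂μ) ^ (1 / p)) := lintegral_mono fun s => h1 _
    _ = μ (ball 0 1) ^ (1 - 1 / p) * (ENNReal.ofReal (e ^ (-(Module.finrank ℝ E / p))) *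
        ∫⁻ s in Ioo (0 : ℝ) 1, (∫⁻ y in ball x e, f (e ^ 2 * s, y) ^ p ∂μ) ^ (1 / p)) := by
      have hm' : Measurable fun s : ℝ =>
          (∫⁻ y in ball x e, f (e ^ 2 * s, y) ^ p ∂μ) ^ (1 / p) :=
        (hm.comp (measurable_const_mul (e ^ 2))).pow_const _
      rw [lintegral_const_mul _ (hm'.const_mul _), lintegral_const_mul _ hm']
    _ ≤ μ (ball 0 1) ^ (1 - 1 / p) * (ENNReal.ofReal (e ^ (-(Module.finrank ℝ E / p))) *
        (ENNReal.ofReal (e ^ (-(2 / q))) * cylNorm μ p q f e (0, x))) := by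
      gcongr
      exact lintegral_sliceNorm_le μ hp hq hf he le_rfl x
    _ = _ := by
      rw [neg_add, Real.rpow_add he, ENNReal.ofReal_mul (by positivity), mul_assoc]

/-- Young's inequality for the average over a small ball. -/
theorem lintegral_rpow_ballMean_le (hp : 1 ≤ p) (hr : p ≤ r) {g : E → ℝ≥0∞} (hg : Measurable g)
    {e ρ : ℝ} (he : 0 < e) (heρ : e ≤ ρ) (x₀ : E) :
    (∫⁻ x in ball x₀ ρ, (∫⁻ y in ball (0 : E) 1, g (x + e • y) ∂μ) ^ r ∂μ) ^ (1 / r)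
      ≤ μ (ball 0 1) ^ (1 - 1 / p + 1 / r) *
        (ENNReal.ofReal (e ^ ((Module.finrank ℝ E : ℝ) / r - Module.finrank ℝ E / p)) *
        (∫⁻ x in ball x₀ (2 * ρ), g x ^ p ∂μ) ^ (1 / p)) := by
  have hp0 : 0 < p := by linarith
  have hr0 : 0 < r := by linarith
  set V := μ (ball (0 : E) 1)
  set D : ℝ := (Module.finrank ℝ E : ℝ)
  set M := ∫⁻ x in ball x₀ (2 * ρ), g x ^ p ∂μ
  have hrp : 0 ≤ r / p - 1 := by rw [sub_nonneg, le_div_iff₀ hp0]; linarith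
  have hp1 : 0 ≤ 1 - 1 / p := by rw [sub_nonneg, div_le_one hp0]; exact hp
  have hm : Measurable fun w : E × E => g (w.1 + e • w.2) ^ p :=
    (hg.comp (Continuous.measurable (by fun_prop))).pow_const p
  have hF : ∀ x ∈ ball x₀ ρ, ∫⁻ y in ball (0 : E) 1, g (x + e • y) ^ p ∂μ
      ≤ ENNReal.ofReal (e ^ (-D)) * M := by
    intro x hx
    rw [lintegral_unit_ball_comp μ he x (fun y => g y ^ p)]
    refine mul_le_mul' le_rfl (lintegral_mono_set (ball_subset_ball' ?_))
    rw [mem_ball] at hx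
    linarith
  have h1 : ∀ x ∈ ball x₀ ρ, (∫⁻ y in ball (0 : E) 1, g (x + e • y) ∂μ) ^ r
      ≤ V ^ ((1 - 1 / p) * r) * ((ENNReal.ofReal (e ^ (-D)) * M) ^ (r / p - 1) *
        ∫⁻ y in ball (0 : E) 1, g (x + e • y) ^ p ∂μ) := by
    intro x hx
    have h2 := lintegral_le_measure_rpow_mul (μ.restrict (ball 0 1)) hp
      (g := fun y => g (x + e • y)) (hg.comp (Continuous.measurable (by fun_prop))).aemeasurable
    rw [Measure.restrict_apply_univ] at h2
    refine (ENNReal.rpow_le_rpow h2 hr0.le).trans ?_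
    rw [ENNReal.mul_rpow_of_nonneg _ _ hr0.le, ← ENNReal.rpow_mul, ← ENNReal.rpow_mul]
    refine mul_le_mul' le_rfl ?_
    rw [show 1 / p * r = (r / p - 1) + 1 by ring, ENNReal.rpow_add_of_nonneg _ _ hrp zero_le_one,
      ENNReal.rpow_one]
    gcongr
    exact hF x hx
  have h3 : ∫⁻ x in ball x₀ ρ, ∫⁻ y in ball (0 : E) 1, g (x + e • y) ^ p ∂μ ∂μ ≤ M * V := by
    rw [lintegral_lintegral_swap (f := fun x y => g (x + e • y) ^ p) hm.aemeasurable]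
    calc _ ≤ ∫⁻ y in ball (0 : E) 1, M ∂μ := by
          refine setLIntegral_mono measurable_const fun y hy => ?_
          refine lintegral_ball_add_le μ (fun x => g x ^ p) x₀ (e • y) ?_
          rw [norm_smul, Real.norm_eq_abs, abs_of_pos he]
          have : ‖y‖ < 1 := by simpa using hy
          nlinarith
      _ = M * V := by simp [V]
  have hmi : Measurable fun x => ∫⁻ y in ball (0 : E) 1, g (x + e • y) ^ p ∂μ :=
    Measurable.lintegral_prod_right' hm
  have h4 : ∫⁻ x in ball x₀ ρ, (∫⁻ y in ball (0 : E) 1, g (x + e • y) ∂μ) ^ r ∂μ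
      ≤ V ^ ((1 - 1 / p + 1 / r) * r) *
        (ENNReal.ofReal (e ^ (-D)) ^ (r / p - 1) * M ^ (r / p)) := by
    calc _ ≤ ∫⁻ x in ball x₀ ρ, V ^ ((1 - 1 / p) * r) *
          ((ENNReal.ofReal (e ^ (-D)) * M) ^ (r / p - 1) *
          ∫⁻ y in ball (0 : E) 1, g (x + e • y) ^ p ∂μ) ∂μ :=
        setLIntegral_mono ((hmi.const_mul _).const_mul _) h1
      _ ≤ V ^ ((1 - 1 / p) * r) * ((ENNReal.ofReal (e ^ (-D)) * M) ^ (r / p - 1) * (M * V)) := by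
        rw [lintegral_const_mul _ (hmi.const_mul _), lintegral_const_mul _ hmi]
        gcongr
      _ = _ := by
        rw [ENNReal.mul_rpow_of_nonneg _ _ hrp,
          show (1 - 1 / p + 1 / r) * r = (1 - 1 / p) * r + 1 by field_simp,
          show M ^ (r / p) = M ^ ((r / p - 1) + 1) by ring_nf,
          ENNReal.rpow_add_of_nonneg _ _ (by positivity) zero_le_one,
          ENNReal.rpow_add_of_nonneg _ _ hrp zero_le_one, ENNReal.rpow_one, ENNReal.rpow_one]
        ring
  refine (ENNReal.rpow_le_rpow h4 (by positivity)).trans (le_of_eq ?_)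
  rw [ENNReal.mul_rpow_of_nonneg _ _ (by positivity),
    ENNReal.mul_rpow_of_nonneg _ _ (by positivity),
    ← ENNReal.rpow_mul, ← ENNReal.rpow_mul, ← ENNReal.rpow_mul, mul_assoc,
    mul_one_div_cancel hr0.ne',
    mul_one, ENNReal.ofReal_rpow_of_pos (by positivity), ← Real.rpow_mul he.le]
  rw [show -D * ((r / p - 1) * (1 / r)) = D / r - D / p by field_simp; ring,
    show r / p * (1 / r) = 1 / p by field_simp]

end LocalEstimates

theorem lintegral_Ioo_rpow_sub_one {κ ρ : ℝ} (hκ : 0 < κ) (hρ : 0 < ρ) :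
    ∫⁻ e in Ioo 0 ρ, ENNReal.ofReal (e ^ (κ - 1)) = ENNReal.ofReal (ρ ^ κ / κ) := by
  have hint : IntervalIntegrable (fun e : ℝ => e ^ (κ - 1)) volume 0 ρ :=
    intervalIntegral.intervalIntegrable_rpow' (by linarith)
  have h1 : IntegrableOn (fun e : ℝ => e ^ (κ - 1)) (Ioo 0 ρ) :=
    (intervalIntegrable_iff_integrableOn_Ioo_of_le hρ.le).1 hint
  rw [← ofReal_integral_eq_lintegral_ofReal h1
    ((ae_restrict_iff' measurableSet_Ioo).2 (.of_forall fun e he => Real.rpow_nonneg he.1.le _)),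
    ← integral_Ioc_eq_integral_Ioo, ← intervalIntegral.integral_of_le hρ.le,
    integral_rpow (Or.inl (by linarith))]
  simp [Real.zero_rpow hκ.ne']

theorem lintegral_Ico_rpow_sub_one_le {κ ρ : ℝ} (hκ : κ < 0) (hρ : 0 < ρ) (hρ1 : ρ ≤ 1) :
    ∫⁻ e in Ico ρ 1, ENNReal.ofReal (e ^ (κ - 1)) ≤ ENNReal.ofReal (ρ ^ κ / -κ) := by
  have h0 : (0 : ℝ) ∉ Set.uIcc ρ 1 := by rw [uIcc_of_le hρ1]; simp [hρ]
  have hint : IntervalIntegrable (fun e : ℝ => e ^ (κ - 1)) volume ρ 1 :=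
    intervalIntegral.intervalIntegrable_rpow (Or.inr h0)
  have h1 : IntegrableOn (fun e : ℝ => e ^ (κ - 1)) (Ico ρ 1) :=
    (intervalIntegrable_iff_integrableOn_Ico_of_le hρ1).1 hint
  rw [← ofReal_integral_eq_lintegral_ofReal h1
    ((ae_restrict_iff' measurableSet_Ico).2
      (.of_forall fun e he => Real.rpow_nonneg (hρ.le.trans he.1) _)),
    integral_Ico_eq_integral_Ioo, ← integral_Ioc_eq_integral_Ioo,
    ← intervalIntegral.integral_of_le hρ1,
    integral_rpow (Or.inr ⟨by linarith, h0⟩)]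
  refine ENNReal.ofReal_le_ofReal ?_
  rw [sub_add_cancel, Real.one_rpow, ← neg_div_neg_eq, neg_sub]
  have : 0 < -κ := by linarith
  gcongr
  linarith

section LocalEstimates

variable {E : Type*} [NormedAddCommGroup E] [NormedSpace ℝ E] [MeasurableSpace E] [BorelSpace E]
  [FiniteDimensional ℝ E] (μ : Measure E) [μ.IsAddHaarMeasure]

variable {p q r a β ρ : ℝ} {f : ℝ × E → ℝ≥0∞} {K : ℝ≥0∞}

theorem lintegral_rpow_nearPart_le (hp : 1 ≤ p) (hq : 1 ≤ q) (hr : p ≤ r) (hf : Measurable f)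
    (hκ : 0 < a + Module.finrank ℝ E / r - Module.finrank ℝ E / p - 2 / q)
    (hρ : 0 < ρ) (x₀ : E) :
    (∫⁻ x in ball x₀ ρ, (∫⁻ e in Ioo 0 ρ,
        ENNReal.ofReal (e ^ (a - 1)) * cylMean μ f e x) ^ r ∂μ) ^ (1 / r)
      ≤ μ (ball 0 1) ^ (1 - 1 / p + 1 / r) *
        (ENNReal.ofReal (ρ ^ (a + Module.finrank ℝ E / r - Module.finrank ℝ E / p - 2 / q) /
          (a + Module.finrank ℝ E / r - Module.finrank ℝ E / p - 2 / q)) *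
        cylNorm μ p q f (2 * ρ) (0, x₀)) := by
  have hp0 : 0 < p := by linarith
  have hr0 : 0 < r := by linarith
  set D : ℝ := (Module.finrank ℝ E : ℝ)
  set C := μ (ball (0 : E) 1) ^ (1 - 1 / p + 1 / r)
  set N := cylNorm μ p q f (2 * ρ) (0, x₀)
  have hwm : Measurable fun e : ℝ => ENNReal.ofReal (e ^ (a - 1)) := by fun_prop
  have hslice : ∀ e ∈ Ioo 0 ρ, (∫⁻ x in ball x₀ ρ, (cylMean μ f e x) ^ r ∂μ) ^ (1 / r)
      ≤ C * (ENNReal.ofReal (e ^ (D / r - D / p - 2 / q)) * N) := by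
    intro e he
    have hm' : Measurable fun s : ℝ =>
        (∫⁻ y in ball x₀ (2 * ρ), f (e ^ 2 * s, y) ^ p ∂μ) ^ (1 / p) :=
      ((measurable_sliceNorm μ hf x₀ (2 * ρ)).comp (measurable_const_mul (e ^ 2))).pow_const _
    calc _ ≤ ∫⁻ s in Ioo (0 : ℝ) 1, (∫⁻ x in ball x₀ ρ,
            (∫⁻ y in ball (0 : E) 1, f (e ^ 2 * s, x + e • y) ∂μ) ^ r ∂μ) ^ (1 / r) :=
          lintegral_rpow_lintegral_le (hp.trans hr)
            (h := fun s x => ∫⁻ y in ball (0 : E) 1, f (e ^ 2 * s, x + e • y) ∂μ)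
            ((measurable_ballInt μ hf).comp (measurable_const.prodMk measurable_id))
      _ ≤ ∫⁻ s in Ioo (0 : ℝ) 1, C * (ENNReal.ofReal (e ^ (D / r - D / p)) *
            (∫⁻ x in ball x₀ (2 * ρ), f (e ^ 2 * s, x) ^ p ∂μ) ^ (1 / p)) :=
          lintegral_mono fun s => lintegral_rpow_ballMean_le μ hp hr
            (hf.comp (measurable_const.prodMk measurable_id)) he.1 he.2.le x₀
      _ = C * (ENNReal.ofReal (e ^ (D / r - D / p)) * ∫⁻ s in Ioo (0 : ℝ) 1,
            (∫⁻ x in ball x₀ (2 * ρ), f (e ^ 2 * s, x) ^ p ∂μ) ^ (1 / p)) := by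
          rw [lintegral_const_mul _ (hm'.const_mul _), lintegral_const_mul _ hm']
      _ ≤ C * (ENNReal.ofReal (e ^ (D / r - D / p)) *
            (ENNReal.ofReal (e ^ (-(2 / q))) * N)) := by
          gcongr
          exact lintegral_sliceNorm_le μ hp hq hf he.1 (by linarith [he.2]) x₀
      _ = _ := by
          rw [← mul_assoc (ENNReal.ofReal _), ← ENNReal.ofReal_mul (Real.rpow_nonneg he.1.le _),
            ← Real.rpow_add he.1, sub_eq_add_neg _ (2 / q)]
  have hm2 : Measurable fun e : ℝ => ENNReal.ofReal
      (e ^ (a + D / r - D / p - 2 / q - 1)) := by fun_prop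
  calc _ ≤ ∫⁻ e in Ioo 0 ρ, (∫⁻ x in ball x₀ ρ,
        (ENNReal.ofReal (e ^ (a - 1)) * cylMean μ f e x) ^ r ∂μ) ^ (1 / r) :=
      lintegral_rpow_lintegral_le (hp.trans hr)
        (h := fun e x => ENNReal.ofReal (e ^ (a - 1)) * cylMean μ f e x)
        ((hwm.comp measurable_fst).mul (measurable_cylMean μ hf))
    _ ≤ ∫⁻ e in Ioo 0 ρ, C * (ENNReal.ofReal (e ^ (a + D / r - D / p - 2 / q - 1)) * N) := by
      refine setLIntegral_mono ((hm2.mul_const _).const_mul _) fun e he => ?_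
      have hcm : Measurable fun x => cylMean μ f e x ^ r :=
        ((measurable_cylMean μ hf).comp (measurable_const.prodMk measurable_id)).pow_const r
      simp only [ENNReal.mul_rpow_of_nonneg _ _ hr0.le]
      rw [lintegral_const_mul _ hcm, ENNReal.mul_rpow_of_nonneg _ _ (by positivity),
        ← ENNReal.rpow_mul, mul_one_div_cancel hr0.ne', ENNReal.rpow_one]
      refine (mul_le_mul' le_rfl (hslice e he)).trans (le_of_eq ?_)
      rw [mul_left_comm, ← mul_assoc (ENNReal.ofReal _),
        ← ENNReal.ofReal_mul (Real.rpow_nonneg he.1.le _), ← Real.rpow_add he.1]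
      congr 4; ring
    _ = _ := by
      rw [lintegral_const_mul _ (hm2.mul_const _), lintegral_mul_const _ hm2,
        lintegral_Ioo_rpow_sub_one hκ hρ]

/-- The Morrey condition, with the measure of the cylinder written out. -/
def MorreyBound (p q β : ℝ) (f : ℝ × E → ℝ≥0∞) (K : ℝ≥0∞) : Prop :=
  ∀ ρ ∈ Ioc (0 : ℝ) 1, ∀ z : ℝ × E,
    cylNorm μ p q f ρ z ≤ ENNReal.ofReal (ρ ^ (Module.finrank ℝ E / p + 2 / q - β)) * K

theorem MorreyBound.cylMean_le (hK : MorreyBound μ p q β f K) (hp : 1 ≤ p) (hq : 1 ≤ q)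
    (hf : Measurable f) {e : ℝ} (he : e ∈ Ioc 0 1) (x : E) :
    cylMean μ f e x ≤ μ (ball 0 1) ^ (1 - 1 / p) * (ENNReal.ofReal (e ^ (-β)) * K) := by
  refine (cylMean_le_cylNorm μ hp hq hf he.1 x).trans (mul_le_mul' le_rfl ?_)
  refine (mul_le_mul' le_rfl (hK e he _)).trans (le_of_eq ?_)
  rw [← mul_assoc, ← ENNReal.ofReal_mul (Real.rpow_nonneg he.1.le _), ← Real.rpow_add he.1]
  congr 3; ring

theorem MorreyBound.farPart_le (hK : MorreyBound μ p q β f K) (hp : 1 ≤ p) (hq : 1 ≤ q)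
    (hf : Measurable f) (hβ : a < β) (hρ : 0 < ρ) (hρ1 : ρ ≤ 1) (x : E) :
    ∫⁻ e in Ico ρ 1, ENNReal.ofReal (e ^ (a - 1)) * cylMean μ f e x
      ≤ μ (ball 0 1) ^ (1 - 1 / p) * (ENNReal.ofReal (ρ ^ (a - β) / (β - a)) * K) := by
  have hm : Measurable fun e : ℝ => ENNReal.ofReal (e ^ (a - β - 1)) := by fun_prop
  calc _ ≤ ∫⁻ e in Ico ρ 1,
        μ (ball 0 1) ^ (1 - 1 / p) * (ENNReal.ofReal (e ^ (a - β - 1)) * K) := by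
        refine setLIntegral_mono ((hm.mul_const _).const_mul _) fun e he => ?_
        have he0 : 0 < e := hρ.trans_le he.1
        refine (mul_le_mul' le_rfl (hK.cylMean_le μ hp hq hf ⟨he0, he.2.le⟩ x)).trans (le_of_eq ?_)
        rw [mul_left_comm, ← mul_assoc (ENNReal.ofReal _),
          ← ENNReal.ofReal_mul (Real.rpow_nonneg he0.le _), ← Real.rpow_add he0]
        congr 4; ring
    _ ≤ _ := by
      rw [lintegral_const_mul _ (hm.mul_const _), lintegral_mul_const _ hm]
      gcongr
      refine (lintegral_Ico_rpow_sub_one_le (by linarith) hρ hρ1).trans (le_of_eq ?_)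
      rw [neg_sub]

theorem lintegral_rpow_const_ball (hr : 0 < r) (hρ : 0 < ρ) (c : ℝ≥0∞) (x₀ : E) :
    (∫⁻ _ in ball x₀ ρ, c ^ r ∂μ) ^ (1 / r)
      = c * (ENNReal.ofReal (ρ ^ (Module.finrank ℝ E / r : ℝ)) * μ (ball 0 1) ^ (1 / r)) := by
  rw [setLIntegral_const, Measure.addHaar_ball_of_pos μ x₀ hρ,
    ENNReal.mul_rpow_of_nonneg _ _ (by positivity), ← ENNReal.rpow_mul,
    mul_one_div_cancel hr.ne', ENNReal.rpow_one, ENNReal.mul_rpow_of_nonneg _ _ (by positivity),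
    ENNReal.ofReal_rpow_of_pos (by positivity), ← Real.rpow_natCast, ← Real.rpow_mul hρ.le,
    mul_one_div]

/-- The potential of `f` along parabolic cylinders based at `(0, x)`. -/
noncomputable def cylPotential (a : ℝ) (f : ℝ × E → ℝ≥0∞) (x : E) : ℝ≥0∞ :=
  ∫⁻ e in Ioo (0 : ℝ) 1, ENNReal.ofReal (e ^ (a - 1)) * cylMean μ f e x

theorem measurable_cylPotential (a : ℝ) (hf : Measurable f) :
    Measurable (cylPotential μ a f) := by
  have hwm : Measurable fun e : ℝ => ENNReal.ofReal (e ^ (a - 1)) := by fun_prop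
  exact Measurable.lintegral_prod_right'
    (f := fun v : E × ℝ => ENNReal.ofReal (v.2 ^ (a - 1)) * cylMean μ f v.2 v.1)
    ((hwm.comp measurable_snd).mul ((measurable_cylMean μ hf).comp measurable_swap))

theorem exists_cylPotential_bound (hp : 1 ≤ p) (hq : 1 ≤ q) (hr : p ≤ r) (hβ : a < β)
    (hκ : 0 < a + Module.finrank ℝ E / r - Module.finrank ℝ E / p - 2 / q) :
    ∃ C : ℝ≥0∞, C ≠ ∞ ∧ ∀ (f : ℝ × E → ℝ≥0∞) (K : ℝ≥0∞), Measurable f →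
      MorreyBound μ p q β f K → ∀ ρ ∈ Ioc (0 : ℝ) (1 / 2), ∀ x₀ : E,
      (∫⁻ x in ball x₀ ρ, cylPotential μ a f x ^ r ∂μ) ^ (1 / r)
        ≤ C * (ENNReal.ofReal (ρ ^ (a + Module.finrank ℝ E / r - β)) * K) := by
  have hp0 : 0 < p := by linarith
  have hr0 : 0 < r := by linarith
  have hp1 : 0 ≤ 1 - 1 / p := by rw [sub_nonneg, div_le_one hp0]; exact hp
  have hV : μ (ball (0 : E) 1) ≠ ∞ := measure_ball_lt_top.ne
  set D : ℝ := (Module.finrank ℝ E : ℝ)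
  set κ := a + D / r - D / p - 2 / q
  set C₁ := μ (ball (0 : E) 1) ^ (1 - 1 / p + 1 / r) *
    ENNReal.ofReal (κ⁻¹ * 2 ^ (D / p + 2 / q - β))
  set C₂ := μ (ball (0 : E) 1) ^ (1 - 1 / p) * ENNReal.ofReal ((β - a)⁻¹)
    * μ (ball (0 : E) 1) ^ (1 / r)
  refine ⟨C₁ + C₂, ?_, fun f K hf hK ρ hρ x₀ => ?_⟩
  · refine ENNReal.add_ne_top.2 ⟨ENNReal.mul_ne_top ?_ ENNReal.ofReal_ne_top,
      ENNReal.mul_ne_top (ENNReal.mul_ne_top ?_ ENNReal.ofReal_ne_top) ?_⟩ <;>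
    exact ENNReal.rpow_ne_top_of_nonneg (by positivity) hV
  have hwm : Measurable fun e : ℝ => ENNReal.ofReal (e ^ (a - 1)) := by fun_prop
  have hnm : Measurable fun x => ∫⁻ e in Ioo 0 ρ,
      ENNReal.ofReal (e ^ (a - 1)) * cylMean μ f e x :=
    Measurable.lintegral_prod_right'
      (f := fun v : E × ℝ => ENNReal.ofReal (v.2 ^ (a - 1)) * cylMean μ f v.2 v.1)
      ((hwm.comp measurable_snd).mul ((measurable_cylMean μ hf).comp measurable_swap))
  set c := μ (ball 0 1) ^ (1 - 1 / p) * (ENNReal.ofReal (ρ ^ (a - β) / (β - a)) * K)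
  have hsplit : ∀ x, cylPotential μ a f x ≤
      (∫⁻ e in Ioo 0 ρ, ENNReal.ofReal (e ^ (a - 1)) * cylMean μ f e x) + c := by
    intro x
    have hun : Ioo (0 : ℝ) 1 = Ioo 0 ρ ∪ Ico ρ 1 :=
      (Ioo_union_Ico_eq_Ioo hρ.1 (by linarith [hρ.2])).symm
    rw [cylPotential, hun]
    refine (lintegral_union_le _ _ _).trans ?_
    gcongr
    exact hK.farPart_le μ hp hq hf hβ hρ.1 (by linarith [hρ.2]) x
  calc _ ≤ (∫⁻ x in ball x₀ ρ, ((∫⁻ e in Ioo 0 ρ,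
          ENNReal.ofReal (e ^ (a - 1)) * cylMean μ f e x) + c) ^ r ∂μ) ^ (1 / r) := by
        gcongr with x
        exact hsplit x
    _ ≤ (∫⁻ x in ball x₀ ρ, (∫⁻ e in Ioo 0 ρ,
          ENNReal.ofReal (e ^ (a - 1)) * cylMean μ f e x) ^ r ∂μ) ^ (1 / r)
          + (∫⁻ _ in ball x₀ ρ, c ^ r ∂μ) ^ (1 / r) :=
        ENNReal.lintegral_Lp_add_le hnm.aemeasurable aemeasurable_const (hp.trans hr)
    _ ≤ C₁ * (ENNReal.ofReal (ρ ^ (a + D / r - β)) * K)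
          + C₂ * (ENNReal.ofReal (ρ ^ (a + D / r - β)) * K) := by
        refine add_le_add ?_ (le_of_eq ?_)
        · refine (lintegral_rpow_nearPart_le μ hp hq hr hf hκ hρ.1 x₀).trans ?_
          refine (mul_le_mul' le_rfl (mul_le_mul' le_rfl
            (hK (2 * ρ) ⟨by linarith [hρ.1], by linarith [hρ.2]⟩ _))).trans (le_of_eq ?_)
          have hρ0 := hρ.1
          simp only [C₁]
          rw [mul_assoc (μ _ ^ _), ← mul_assoc (ENNReal.ofReal _), ← mul_assoc (ENNReal.ofReal _),
            ← ENNReal.ofReal_mul (by positivity), ← ENNReal.ofReal_mul (by positivity)]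
          congr 3
          rw [Real.mul_rpow zero_le_two hρ0.le, div_eq_mul_inv, show a + D / r - β
            = κ + (D / p + 2 / q - β) by simp only [κ, D]; ring, Real.rpow_add hρ0]
          ring
        · rw [lintegral_rpow_const_ball μ hr0 hρ.1]
          have hρ0 := hρ.1
          have hba : 0 < β - a := by linarith
          simp only [c, C₂]
          rw [div_eq_mul_inv (ρ ^ (a - β)), ENNReal.ofReal_mul (p := ρ ^ (a - β)) (by positivity),
            show a + D / r - β
            = (a - β) + D / r by ring, Real.rpow_add hρ0, ENNReal.ofReal_mul (by positivity)]
          ring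
    _ = _ := by rw [add_mul]

end LocalEstimates

theorem hasDerivAt_max_zero_pow (n : ℕ) (t : ℝ) :
    HasDerivAt (fun t : ℝ => max 0 t ^ (n + 2)) ((n + 2) * max 0 t ^ (n + 1)) t := by
  rcases lt_trichotomy t 0 with ht | rfl | ht
  · have h : (fun t : ℝ => max 0 t ^ (n + 2)) =ᶠ[nhds t] fun _ => 0 := by
      filter_upwards [gt_mem_nhds ht] with s hs
      simp [max_eq_left hs.le]
    simpa [max_eq_left ht.le] using (hasDerivAt_const t (0 : ℝ)).congr_of_eventuallyEq h
  · have h : (fun t : ℝ => max 0 t ^ (n + 2)) =O[nhds 0] fun t => ‖t - 0‖ ^ (n + 2) := by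
      refine Asymptotics.isBigO_of_le _ fun t => ?_
      simp only [norm_pow, sub_zero, norm_norm]
      refine pow_le_pow_left₀ (norm_nonneg _) ?_ _
      rw [Real.norm_of_nonneg (le_max_left _ _)]
      exact max_le (norm_nonneg _) (le_abs_self _)
    simpa using (h.hasFDerivAt (by omega)).hasDerivAt
  · have h : (fun t : ℝ => max 0 t ^ (n + 2)) =ᶠ[nhds t] fun t => t ^ (n + 2) := by
      filter_upwards [lt_mem_nhds ht] with s hs
      simp [max_eq_right hs.le]
    simpa [max_eq_right ht.le] using (hasDerivAt_pow (n + 2) t).congr_of_eventuallyEq h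

section Bump

variable {E : Type*} [NormedAddCommGroup E]

/-- The positive part of `1 - ‖y‖²`. -/
noncomputable def quadBump (y : E) : ℝ := max 0 (1 - ‖y‖ ^ 2)

theorem quadBump_nonneg (y : E) : 0 ≤ quadBump y := le_max_left _ _

theorem quadBump_le_one (y : E) : quadBump y ≤ 1 :=
  max_le zero_le_one (by linarith [sq_nonneg ‖y‖])

theorem quadBump_eq_zero {y : E} (hy : y ∉ ball (0 : E) 1) : quadBump y = 0 := by
  have : 1 ≤ ‖y‖ := by simpa using hy
  exact max_eq_left (by nlinarith)

theorem continuous_quadBump : Continuous (quadBump : E → ℝ) := by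
  unfold quadBump; fun_prop

variable [InnerProductSpace ℝ E]

theorem hasFDerivAt_quadBump_pow (n : ℕ) (y : E) :
    HasFDerivAt (fun y : E => quadBump y ^ (n + 2))
      ((-2 * (n + 2) * quadBump y ^ (n + 1)) • innerSL ℝ y) y := by
  have h1 : HasFDerivAt (fun y : E => 1 - ‖y‖ ^ 2) (-(2 • innerSL ℝ y)) y :=
    (hasStrictFDerivAt_norm_sq y).hasFDerivAt.const_sub 1
  refine ((hasDerivAt_max_zero_pow n (1 - ‖y‖ ^ 2)).comp_hasFDerivAt y h1).congr_fderiv ?_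
  ext v
  simp [quadBump]
  ring

theorem fderiv_quadBump_pow (n : ℕ) (y v : E) :
    fderiv ℝ (fun y : E => quadBump y ^ (n + 2)) y v
      = -2 * (n + 2) * quadBump y ^ (n + 1) * inner ℝ y v := by
  rw [(hasFDerivAt_quadBump_pow n y).fderiv]; simp

theorem hasCompactSupport_quadBump_pow_mul [FiniteDimensional ℝ E] (n : ℕ) (g : E → ℝ) :
    HasCompactSupport fun y : E => quadBump y ^ (n + 1) * g y := by
  refine HasCompactSupport.of_support_subset_isCompact (isCompact_closedBall (0 : E) 1)
    fun y hy => ?_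
  by_contra h
  exact hy (by simp [quadBump_eq_zero fun h' => h (ball_subset_closedBall h')])

variable [FiniteDimensional ℝ E] [MeasurableSpace E] [BorelSpace E] (μ : Measure E)
  [μ.IsAddHaarMeasure]

theorem integrable_quadBump_pow_mul (n : ℕ) {g : E → ℝ} (hg : Continuous g) :
    Integrable (fun y : E => quadBump y ^ (n + 1) * g y) μ :=
  ((continuous_quadBump.pow _).mul hg).integrable_of_hasCompactSupport
    (hasCompactSupport_quadBump_pow_mul n g)

theorem integral_quadBump_sq_pos : 0 < ∫ y : E, quadBump y ^ 2 ∂μ := by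
  refine (continuous_quadBump.pow 2).integral_pos_of_hasCompactSupport_nonneg_nonzero (x := 0)
    ?_ (fun y => sq_nonneg _) (by simp [quadBump])
  simpa using hasCompactSupport_quadBump_pow_mul (E := E) 1 fun _ => 1

/-- Integration by parts against a power of the bump. -/
theorem integral_quadBump_pow_mul_fderiv (n : ℕ) {g : E → ℝ} (hg : ContDiff ℝ 1 g) (v : E) :
    ∫ y, quadBump y ^ (n + 2) * fderiv ℝ g y v ∂μ
      = 2 * (n + 2) * ∫ y, quadBump y ^ (n + 1) * (inner ℝ y v * g y) ∂μ := by
  have hg' : Continuous fun y => fderiv ℝ g y v := by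
    have := hg.continuous_fderiv (by norm_num)
    fun_prop
  have hi := integrable_quadBump_pow_mul μ n (g := fun y => inner ℝ y v * g y)
    ((continuous_id.inner continuous_const).mul hg.continuous)
  rw [integral_mul_fderiv_eq_neg_fderiv_mul_of_integrable (f := fun y => quadBump y ^ (n + 2)),
    ← integral_neg, ← integral_const_mul]
  · congr 1; ext y; rw [fderiv_quadBump_pow]; ring
  · refine (hi.const_mul (-2 * (n + 2))).congr (.of_forall fun y => ?_)
    simp only [fderiv_quadBump_pow]; ring
  · exact integrable_quadBump_pow_mul μ (n + 1) hg'
  · exact integrable_quadBump_pow_mul μ (n + 1) hg.continuous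
  · exact fun y _ => (hasFDerivAt_quadBump_pow n y).differentiableAt
  · exact fun y _ => hg.differentiable (by norm_num) y

/-- Comparison of the value of `G` at `(0, x)` with a weighted mean over a cylinder. -/
theorem quadBump_mean_identity {G : ℝ × E → ℝ} (hG : ContDiff ℝ 1 G) (s : ℝ) (x : E) :
    (∫ y, quadBump y ^ 2 ∂μ) * G (0, x) = ∫ y, quadBump y ^ 2 * G (s, x + y) ∂μ
      - ∫ e in Ioc (0 : ℝ) 1, ∫ y, quadBump y ^ 2 *
          fderiv ℝ G (e ^ 2 * s, x + e • y) (2 * e * s, y) ∂μ := by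
  have hG' : Continuous (fderiv ℝ G) := hG.continuous_fderiv (by norm_num)
  have hc : Continuous fun w : ℝ × E => quadBump w.2 ^ 2 *
      fderiv ℝ G (w.1 ^ 2 * s, x + w.1 • w.2) (2 * w.1 * s, w.2) := by
    have := continuous_quadBump (E := E)
    refine ((this.comp continuous_snd).pow 2).mul (Continuous.clm_apply (hG'.comp ?_) ?_) <;>
      fun_prop
  have hft : ∀ y, G (s, x + y) - G (0, x)
      = ∫ e in Ioc (0 : ℝ) 1, fderiv ℝ G (e ^ 2 * s, x + e • y) (2 * e * s, y) := by
    intro y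
    rw [← intervalIntegral.integral_of_le zero_le_one,
      intervalIntegral.integral_eq_sub_of_hasDerivAt (f := fun e => G (e ^ 2 * s, x + e • y))]
    · simp
    · intro e _
      have h1 : HasDerivAt (fun e : ℝ => (e ^ 2 * s, x + e • y)) (2 * e * s, y) e := by
        refine HasDerivAt.prodMk ?_ ?_
        · simpa using (hasDerivAt_pow 2 e).mul_const s
        · simpa using ((hasDerivAt_id e).smul_const y).const_add x
      exact (hG.differentiable (by norm_num) _).hasFDerivAt.comp_hasDerivAt e h1
    · refine Continuous.intervalIntegrable (Continuous.clm_apply (hG'.comp ?_) ?_) _ _ <;> fun_prop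
  have hball : ∀ F : E → ℝ, ∫ y in closedBall (0 : E) 1, quadBump y ^ 2 * F y ∂μ
      = ∫ y, quadBump y ^ 2 * F y ∂μ := fun F =>
    setIntegral_eq_integral_of_forall_compl_eq_zero fun y hy => by
      simp [quadBump_eq_zero fun h' => hy (ball_subset_closedBall h')]
  have hswap : ∫ y, quadBump y ^ 2 * (G (s, x + y) - G (0, x)) ∂μ
      = ∫ e in Ioc (0 : ℝ) 1, ∫ y, quadBump y ^ 2 *
          fderiv ℝ G (e ^ 2 * s, x + e • y) (2 * e * s, y) ∂μ := by
    simp only [hft, ← hball]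
    simp only [← integral_const_mul]
    refine (integral_integral_swap (f := fun e y => quadBump y ^ 2 *
          fderiv ℝ G (e ^ 2 * s, x + e • y) (2 * e * s, y)) ?_).symm
    rw [Measure.prod_restrict]
    exact (hc.continuousOn.integrableOn_compact
      (isCompact_Icc.prod (isCompact_closedBall (0 : E) 1))).mono_set
      (prod_mono Ioc_subset_Icc_self Subset.rfl)
  rw [← hswap, ← integral_mul_const, ← integral_sub]
  · congr 1; ext y; ring
  · refine integrable_quadBump_pow_mul μ 1 (hG.continuous.comp ?_)
    fun_prop
  · refine integrable_quadBump_pow_mul μ 1 ((hG.continuous.comp ?_).sub continuous_const)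
    fun_prop

end Bump

theorem enorm_integral_le_ball {E : Type*} [NormedAddCommGroup E] [MeasurableSpace E]
    [OpensMeasurableSpace E] (μ : Measure E) {F : E → ℝ} {c : ℝ≥0∞} (hc : c ≠ ∞) {g : E → ℝ≥0∞}
    (h0 : ∀ y ∉ ball (0 : E) 1, F y = 0) (h1 : ∀ y ∈ ball (0 : E) 1, ‖F y‖ₑ ≤ c * g y) :
    ‖∫ y, F y ∂μ‖ₑ ≤ c * ∫⁻ y in ball (0 : E) 1, g y ∂μ := by
  rw [← lintegral_const_mul' _ _ hc, ← lintegral_indicator measurableSet_ball]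
  refine (enorm_integral_le_lintegral_enorm _).trans (lintegral_mono fun y => ?_)
  by_cases hy : y ∈ ball (0 : E) 1
  · rw [indicator_of_mem hy]; exact h1 y hy
  · simp [h0 y hy]

section Partials

variable {E : Type*} [NormedAddCommGroup E] [NormedSpace ℝ E]

/-- The time derivative of `u`. -/
noncomputable def timePartial (u : ℝ × E → ℝ) (z : ℝ × E) : ℝ := fderiv ℝ u z (1, 0)

/-- The spatial differential of `u`. -/
noncomputable def spacePartial {F : Type*} [NormedAddCommGroup F] [NormedSpace ℝ F]
    (u : ℝ × E → F) (z : ℝ × E) : E →L[ℝ] F :=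
  (fderiv ℝ u z).comp (ContinuousLinearMap.inr ℝ ℝ E)

theorem contDiff_timePartial {u : ℝ × E → ℝ} (hu : ContDiff ℝ 2 u) :
    ContDiff ℝ 1 (timePartial u) :=
  (hu.fderiv_right (m := 1) (by norm_num)).clm_apply contDiff_const

theorem contDiff_spacePartial {F : Type*} [NormedAddCommGroup F] [NormedSpace ℝ F]
    {u : ℝ × E → F} {m : WithTop ℕ∞} (hu : ContDiff ℝ (m + 1) u) :
    ContDiff ℝ m (spacePartial u) :=
  (hu.fderiv_right le_rfl).clm_comp contDiff_const

theorem hasFDerivAt_slice {F : Type*} [NormedAddCommGroup F] [NormedSpace ℝ F]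
    {u : ℝ × E → F} (hu : ContDiff ℝ 1 u) (t e : ℝ) (x y : E) :
    HasFDerivAt (fun y => u (t, x + e • y)) (e • spacePartial u (t, x + e • y)) y := by
  have h1 : HasFDerivAt (fun y : E => (t, x + e • y))
      ((0 : E →L[ℝ] ℝ).prod (e • ContinuousLinearMap.id ℝ E)) y :=
    (hasFDerivAt_const t y).prodMk (((hasFDerivAt_id y).const_smul e).const_add x)
  refine ((hu.differentiable (by norm_num) (t, x + e • y)).hasFDerivAt.comp y h1).congr_fderiv ?_
  ext v
  simp only [spacePartial, ContinuousLinearMap.comp_apply, smul_apply,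
    ContinuousLinearMap.prod_apply, ContinuousLinearMap.inr_apply, zero_apply,
    ContinuousLinearMap.id_apply]
  rw [← map_smul]; simp

theorem fderiv_apply_prod {u : ℝ × E → ℝ} (z : ℝ × E) (τ : ℝ) (y : E) :
    fderiv ℝ u z (τ, y) = τ * timePartial u z + spacePartial u z y := by
  have : ((τ, y) : ℝ × E) = τ • ((1 : ℝ), (0 : E)) + (0, y) := by simp
  rw [this, map_add, map_smul]; rfl

end Partials

section Pointwise

variable {E : Type*} [NormedAddCommGroup E] [InnerProductSpace ℝ E] [FiniteDimensional ℝ E]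
  [MeasurableSpace E] [BorelSpace E] (μ : Measure E) [μ.IsAddHaarMeasure]

theorem enorm_trace_le {G : ℝ × E → ℝ} (hG : ContDiff ℝ 1 G) {f w : ℝ × E → ℝ≥0∞}
    (hf : Measurable f) (hw : Measurable w) {a : ℝ} (hGw : ∀ z, ‖G z‖ₑ ≤ w z)
    (hbd : ∀ e ∈ Ioo (0 : ℝ) 1, ∀ s ∈ Ioo (0 : ℝ) 1, ∀ x : E,
      ‖∫ y, quadBump y ^ 2 * fderiv ℝ G (e ^ 2 * s, x + e • y) (2 * e * s, y) ∂μ‖ₑ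
        ≤ ENNReal.ofReal (e ^ (a - 1)) * ∫⁻ y in ball (0 : E) 1, f (e ^ 2 * s, x + e • y) ∂μ)
    (x : E) :
    ‖∫ y : E, quadBump y ^ 2 ∂μ‖ₑ * ‖G (0, x)‖ₑ
      ≤ cylMean μ w 1 x + cylPotential μ a f x := by
  have hwm : Measurable fun e : ℝ => ENNReal.ofReal (e ^ (a - 1)) := by fun_prop
  have key : ∀ s ∈ Ioo (0 : ℝ) 1, ‖∫ y : E, quadBump y ^ 2 ∂μ‖ₑ * ‖G (0, x)‖ₑ
      ≤ (∫⁻ y in ball (0 : E) 1, w (1 ^ 2 * s, x + (1 : ℝ) • y) ∂μ) + ∫⁻ e in Ioo (0 : ℝ) 1,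
        ENNReal.ofReal (e ^ (a - 1)) *
          ∫⁻ y in ball (0 : E) 1, f (e ^ 2 * s, x + e • y) ∂μ := by
    intro s hs
    rw [← enorm_mul, quadBump_mean_identity μ hG s x]
    refine (enorm_sub_le).trans (add_le_add ?_ ?_)
    · refine (enorm_integral_le_lintegral_enorm _).trans ?_
      rw [← lintegral_indicator measurableSet_ball]
      refine lintegral_mono fun y => ?_
      by_cases hy : y ∈ ball (0 : E) 1
      · rw [indicator_of_mem hy, enorm_mul, one_pow, one_mul, one_smul]
        refine (mul_le_mul' ?_ (hGw _)).trans (one_mul _).le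
        rw [Real.enorm_eq_ofReal (sq_nonneg _), ENNReal.ofReal_le_one]
        exact pow_le_one₀ (quadBump_nonneg y) (quadBump_le_one y)
      · simp [quadBump_eq_zero hy]
    · rw [integral_Ioc_eq_integral_Ioo]
      refine (enorm_integral_le_lintegral_enorm _).trans ?_
      exact setLIntegral_mono' measurableSet_Ioo fun e he => hbd e he s hs x
  have hm1 : Measurable fun s : ℝ =>
      ∫⁻ y in ball (0 : E) 1, w (1 ^ 2 * s, x + (1 : ℝ) • y) ∂μ :=
    (measurable_ballInt μ hw).comp (g := fun w' : ℝ × ℝ × E =>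
      ∫⁻ y in ball (0 : E) 1, w (w'.1 ^ 2 * w'.2.1, w'.2.2 + w'.1 • y) ∂μ)
      (measurable_const.prodMk (measurable_id.prodMk measurable_const))
  have hm2 : Measurable fun v : ℝ × ℝ => ENNReal.ofReal (v.2 ^ (a - 1)) *
      ∫⁻ y in ball (0 : E) 1, f (v.2 ^ 2 * v.1, x + v.2 • y) ∂μ :=
    (hwm.comp measurable_snd).mul ((measurable_ballInt μ hf).comp (g := fun w' : ℝ × ℝ × E =>
      ∫⁻ y in ball (0 : E) 1, f (w'.1 ^ 2 * w'.2.1, w'.2.2 + w'.1 • y) ∂μ)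
      (measurable_snd.prodMk (measurable_fst.prodMk measurable_const)))
  calc _ = ∫⁻ _ in Ioo (0 : ℝ) 1, ‖∫ y : E, quadBump y ^ 2 ∂μ‖ₑ * ‖G (0, x)‖ₑ := by simp
    _ ≤ ∫⁻ s in Ioo (0 : ℝ) 1, ((∫⁻ y in ball (0 : E) 1, w (1 ^ 2 * s, x + (1 : ℝ) • y) ∂μ) +
        ∫⁻ e in Ioo (0 : ℝ) 1, ENNReal.ofReal (e ^ (a - 1)) *
          ∫⁻ y in ball (0 : E) 1, f (e ^ 2 * s, x + e • y) ∂μ) :=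
      setLIntegral_mono' measurableSet_Ioo key
    _ = _ := by
      rw [lintegral_add_left hm1, lintegral_lintegral_swap (f := fun s e =>
        ENNReal.ofReal (e ^ (a - 1)) *
          ∫⁻ y in ball (0 : E) 1, f (e ^ 2 * s, x + e • y) ∂μ) hm2.aemeasurable]
      rw [cylMean, cylPotential]
      congr 1
      refine lintegral_congr fun e => ?_
      rw [lintegral_const_mul, cylMean]
      exact (measurable_ballInt μ hf).comp (g := fun w' : ℝ × ℝ × E =>
        ∫⁻ y in ball (0 : E) 1, f (w'.1 ^ 2 * w'.2.1, w'.2.2 + w'.1 • y) ∂μ)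
        (measurable_const.prodMk (measurable_id.prodMk measurable_const))

end Pointwise

section PartialsTwo

variable {E : Type*} [NormedAddCommGroup E] [NormedSpace ℝ E] {u : ℝ × E → ℝ}

theorem contDiff_slice {F : Type*} [NormedAddCommGroup F] [NormedSpace ℝ F]
    {g : ℝ × E → F} {m : WithTop ℕ∞} (hg : ContDiff ℝ m g) (t e : ℝ) (x : E) :
    ContDiff ℝ m fun y => g (t, x + e • y) :=
  hg.comp (contDiff_const.prodMk (contDiff_const.add (contDiff_id.const_smul e)))

theorem fderiv_slice_spacePartial (hu : ContDiff ℝ 2 u) (t e : ℝ) (x y v w : E) :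
    fderiv ℝ (fun y => spacePartial u (t, x + e • y) w) y v
      = e * spacePartial (spacePartial u) (t, x + e • y) v w := by
  have h := hasFDerivAt_slice (contDiff_spacePartial (m := 1) hu) t e x y
  rw [(h.clm_apply (hasFDerivAt_const w y)).fderiv]
  simp

theorem fderiv_slice (hu : ContDiff ℝ 1 u) (t e : ℝ) (x y v : E) :
    fderiv ℝ (fun y => u (t, x + e • y)) y v = e * spacePartial u (t, x + e • y) v := by
  rw [(hasFDerivAt_slice hu t e x y).fderiv]; simp

theorem fderiv_spacePartial_apply (hu : ContDiff ℝ 2 u) (z : ℝ × E) (v : E) (w : ℝ × E) :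
    fderiv ℝ (fun z => spacePartial u z v) z w = fderiv ℝ (fderiv ℝ u) z w (0, v) := by
  have h : HasFDerivAt (fderiv ℝ u) (fderiv ℝ (fderiv ℝ u) z) z :=
    ((hu.fderiv_right (m := 1) (by norm_num)).differentiable (by norm_num) z).hasFDerivAt
  have h2 := h.clm_apply (hasFDerivAt_const ((0 : ℝ), v) z)
  rw [show (fun z => spacePartial u z v) = fun z => fderiv ℝ u z (0, v) from rfl, h2.fderiv]
  simp

theorem timePartial_spacePartial (hu : ContDiff ℝ 2 u) (z : ℝ × E) (v : E) :
    timePartial (fun z => spacePartial u z v) z = spacePartial (timePartial u) z v := by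
  have h : HasFDerivAt (fderiv ℝ u) (fderiv ℝ (fderiv ℝ u) z) z :=
    ((hu.fderiv_right (m := 1) (by norm_num)).differentiable (by norm_num) z).hasFDerivAt
  have h2 := h.clm_apply (hasFDerivAt_const ((1 : ℝ), (0 : E)) z)
  have hs : fderiv ℝ (fderiv ℝ u) z (1, 0) (0, v) = fderiv ℝ (fderiv ℝ u) z (0, v) (1, 0) :=
    (hu.contDiffAt.isSymmSndFDerivAt (by simp)).eq _ _
  rw [timePartial, fderiv_spacePartial_apply hu, hs, spacePartial,
    show timePartial u = fun z => fderiv ℝ u z (1, 0) from rfl, h2.fderiv]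
  simp

theorem spacePartial_spacePartial_apply (hu : ContDiff ℝ 2 u) (z : ℝ × E) (y v : E) :
    spacePartial (fun z => spacePartial u z v) z y = spacePartial (spacePartial u) z y v := by
  have h : HasFDerivAt (spacePartial u) (fderiv ℝ (spacePartial u) z) z :=
    ((contDiff_spacePartial (m := 1) hu).differentiable (by norm_num) z).hasFDerivAt
  have h2 := h.clm_apply (hasFDerivAt_const v z)
  rw [spacePartial, h2.fderiv]
  simp [spacePartial]

end PartialsTwo

section Identities

variable {E : Type*} [NormedAddCommGroup E] [InnerProductSpace ℝ E] [FiniteDimensional ℝ E]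
  [MeasurableSpace E] [BorelSpace E] (μ : Measure E) [μ.IsAddHaarMeasure] {u : ℝ × E → ℝ}

theorem integral_quadBump_mul_fderiv_eq (hu : ContDiff ℝ 2 u) (e s : ℝ) (x : E) :
    ∫ y, quadBump y ^ 2 * fderiv ℝ u (e ^ 2 * s, x + e • y) (2 * e * s, y) ∂μ
      = ∫ y, (quadBump y ^ 2 * (2 * e * s * timePartial u (e ^ 2 * s, x + e • y)) +
          ∑ i, quadBump y ^ 3 * (6⁻¹ * (e * spacePartial (spacePartial u) (e ^ 2 * s, x + e • y)
            (stdOrthonormalBasis ℝ E i) (stdOrthonormalBasis ℝ E i)))) ∂μ := by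
  set b := stdOrthonormalBasis ℝ E
  have hT : Continuous fun y : E => timePartial u (e ^ 2 * s, x + e • y) :=
    (contDiff_slice (contDiff_timePartial hu) _ e x).continuous
  have hP : ContDiff ℝ 1 fun y : E => spacePartial u (e ^ 2 * s, x + e • y) :=
    contDiff_slice (contDiff_spacePartial hu) _ e x
  have hPi : ∀ i, ContDiff ℝ 1 fun y : E => spacePartial u (e ^ 2 * s, x + e • y) (b i) :=
    fun i => hP.clm_apply contDiff_const
  have hH : Continuous fun y : E => spacePartial (spacePartial u) (e ^ 2 * s, x + e • y) :=
    (contDiff_slice (contDiff_spacePartial (m := 0) (contDiff_spacePartial (m := 1) hu))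
      _ e x).continuous
  have hHi : ∀ i, Integrable (fun y : E => quadBump y ^ 3 * (6⁻¹ * (e *
      spacePartial (spacePartial u) (e ^ 2 * s, x + e • y) (b i) (b i)))) μ := fun i =>
    integrable_quadBump_pow_mul μ 2 (by fun_prop)
  have hIi : ∀ i, Integrable (fun y : E => quadBump y ^ 2 * (inner ℝ y (b i) *
      spacePartial u (e ^ 2 * s, x + e • y) (b i))) μ := fun i =>
    integrable_quadBump_pow_mul μ 1
      ((continuous_id.inner continuous_const).mul (hPi i).continuous)
  have hTi : Integrable (fun y : E => quadBump y ^ 2 *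
      (2 * e * s * timePartial u (e ^ 2 * s, x + e • y))) μ :=
    integrable_quadBump_pow_mul μ 1 (by fun_prop)
  have hsplit : ∀ y : E,
      quadBump y ^ 2 * fderiv ℝ u (e ^ 2 * s, x + e • y) (2 * e * s, y)
        = quadBump y ^ 2 * (2 * e * s * timePartial u (e ^ 2 * s, x + e • y)) +
          ∑ i, quadBump y ^ 2 * (inner ℝ y (b i) *
            spacePartial u (e ^ 2 * s, x + e • y) (b i)) := by
    intro y
    rw [fderiv_apply_prod, mul_add, ← Finset.mul_sum]
    congr 2
    generalize spacePartial u (e ^ 2 * s, x + e • y) = A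
    conv_lhs => rw [← b.sum_repr' y]
    simp [map_sum, real_inner_comm]
  simp only [hsplit]
  rw [integral_add hTi (integrable_finsetSum _ fun i _ => hIi i),
    integral_add hTi (integrable_finsetSum _ fun i _ => hHi i),
    integral_finsetSum _ fun i _ => hIi i, integral_finsetSum _ fun i _ => hHi i]
  congr 1
  refine Finset.sum_congr rfl fun i _ => ?_
  have := integral_quadBump_pow_mul_fderiv μ 1 (hPi i) (b i)
  simp only [fderiv_slice_spacePartial hu] at this
  norm_num at this
  simp only [mul_left_comm _ (6⁻¹ : ℝ)]
  rw [integral_const_mul, this]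
  ring

theorem integral_quadBump_mul_fderiv_spacePartial_eq (hu : ContDiff ℝ 2 u) (e s : ℝ) (x v : E) :
    ∫ y, quadBump y ^ 2 *
        fderiv ℝ (fun z => spacePartial u z v) (e ^ 2 * s, x + e • y) (2 * e * s, y) ∂μ
      = ∫ y, (quadBump y ^ 1 * (8 * s * inner ℝ y v * timePartial u (e ^ 2 * s, x + e • y)) +
          quadBump y ^ 2 * spacePartial (spacePartial u) (e ^ 2 * s, x + e • y) y v) ∂μ := by
  have hT : ContDiff ℝ 1 fun y : E => timePartial u (e ^ 2 * s, x + e • y) :=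
    contDiff_slice (contDiff_timePartial hu) _ e x
  have hT' : Continuous fun y : E => spacePartial (timePartial u) (e ^ 2 * s, x + e • y) :=
    (contDiff_slice (contDiff_spacePartial (m := 0) (contDiff_timePartial hu)) _ e x).continuous
  have hH : Continuous fun y : E => spacePartial (spacePartial u) (e ^ 2 * s, x + e • y) :=
    (contDiff_slice (contDiff_spacePartial (m := 0) (contDiff_spacePartial (m := 1) hu))
      _ e x).continuous
  have hHi : Integrable (fun y : E => quadBump y ^ 2 *
      spacePartial (spacePartial u) (e ^ 2 * s, x + e • y) y v) μ :=
    integrable_quadBump_pow_mul μ 1 (by fun_prop)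
  have hTi : Integrable (fun y : E => quadBump y ^ 1 * (8 * s * inner ℝ y v *
      timePartial u (e ^ 2 * s, x + e • y))) μ :=
    integrable_quadBump_pow_mul μ 0 (by have := hT.continuous; fun_prop)
  have hDi : Integrable (fun y : E => quadBump y ^ 2 * (2 * e * s *
      spacePartial (timePartial u) (e ^ 2 * s, x + e • y) v)) μ :=
    integrable_quadBump_pow_mul μ 1 (by fun_prop)
  simp only [fderiv_apply_prod, timePartial_spacePartial hu, spacePartial_spacePartial_apply hu,
    mul_add]
  rw [integral_add hDi hHi, integral_add hTi hHi]
  congr 1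
  have := integral_quadBump_pow_mul_fderiv μ 0 hT v
  simp only [fderiv_slice (contDiff_timePartial hu)] at this
  norm_num at this
  have h1 : ∀ y : E, quadBump y ^ 2 * (2 * e * s *
      spacePartial (timePartial u) (e ^ 2 * s, x + e • y) v) = (2 * s) * (quadBump y ^ 2 * (e *
      spacePartial (timePartial u) (e ^ 2 * s, x + e • y) v)) := fun y => by ring
  have h2 : ∀ y : E, quadBump y ^ 1 * (8 * s * inner ℝ y v *
      timePartial u (e ^ 2 * s, x + e • y)) = (8 * s) * (quadBump y *
      (inner ℝ y v * timePartial u (e ^ 2 * s, x + e • y))) := fun y => by ring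
  simp only [h1, h2]
  rw [integral_const_mul, integral_const_mul, this]
  ring

end Identities

section TopOrder

variable {E : Type*} [NormedAddCommGroup E] [NormedSpace ℝ E] {u : ℝ × E → ℝ}

/-- The pointwise size of the derivatives `∂_t u` and `D²u`. -/
noncomputable def topOrder (u : ℝ × E → ℝ) (z : ℝ × E) : ℝ≥0∞ :=
  ‖timePartial u z‖ₑ + ‖spacePartial (spacePartial u) z‖ₑ

theorem enorm_le_mul_topOrder {y C : ℝ} {z : ℝ × E} (hC : 0 ≤ C)
    (h : |y| ≤ C * (|timePartial u z| + ‖spacePartial (spacePartial u) z‖)) :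
    ‖y‖ₑ ≤ ENNReal.ofReal C * topOrder u z := by
  rw [topOrder, ← ofReal_norm, ← ofReal_norm, ← ofReal_norm,
    ← ENNReal.ofReal_add (norm_nonneg _) (norm_nonneg _), ← ENNReal.ofReal_mul hC]
  exact ENNReal.ofReal_le_ofReal h

variable [FiniteDimensional ℝ E] [MeasurableSpace E] [BorelSpace E]

theorem measurable_topOrder (hu : ContDiff ℝ 2 u) : Measurable (topOrder u) :=
  (contDiff_timePartial hu).continuous.enorm.measurable.add
    (contDiff_spacePartial (m := 0) (contDiff_spacePartial (m := 1) hu)).continuous.enorm.measurable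

end TopOrder

section TraceBounds

variable {E : Type*} [NormedAddCommGroup E] [InnerProductSpace ℝ E] [FiniteDimensional ℝ E]
  [MeasurableSpace E] [BorelSpace E] (μ : Measure E) [μ.IsAddHaarMeasure] {u : ℝ × E → ℝ}

theorem enorm_trace_zero_le (hu : ContDiff ℝ 2 u) (x : E) :
    ‖∫ y : E, quadBump y ^ 2 ∂μ‖ₑ * ‖u (0, x)‖ₑ
      ≤ cylMean μ (fun z => ‖u z‖ₑ) 1 x +
        cylPotential μ 2
          (fun z => ENNReal.ofReal (Module.finrank ℝ E + 2) * topOrder u z) x := by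
  refine enorm_trace_le μ (hu.of_le (by norm_num)) ((measurable_topOrder hu).const_mul _)
    hu.continuous.enorm.measurable (fun z => le_rfl) ?_ x
  intro e he s hs x
  rw [integral_quadBump_mul_fderiv_eq μ hu]
  refine enorm_integral_le_ball μ ENNReal.ofReal_ne_top ?_ ?_
  · intro y hy; simp [quadBump_eq_zero hy]
  · intro y _
    have he0 := he.1.le
    have hs0 := hs.1.le
    rw [← mul_assoc (ENNReal.ofReal _), ← ENNReal.ofReal_mul (Real.rpow_nonneg he0 _)]
    refine enorm_le_mul_topOrder (by positivity) ?_
    set z := (e ^ 2 * s, x + e • y)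
    set b := stdOrthonormalBasis ℝ E
    have hQ0 := quadBump_nonneg y
    have hQ1 := quadBump_le_one y
    have hH : ∀ i, |spacePartial (spacePartial u) z (b i) (b i)|
        ≤ ‖spacePartial (spacePartial u) z‖ := fun i => by
      simpa using (spacePartial (spacePartial u) z).le_opNorm₂ (b i) (b i)
    have h1 : |quadBump y ^ 2 * (2 * e * s * timePartial u z)| ≤ e * (2 * |timePartial u z|) := by
      rw [abs_mul, abs_mul, abs_of_nonneg (sq_nonneg _), abs_of_nonneg (by positivity)]
      calc _ ≤ 1 * (2 * e * 1 * |timePartial u z|) := by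
            gcongr
            · exact pow_le_one₀ hQ0 hQ1
            · exact hs.2.le
        _ = _ := by ring
    have h2 : ∀ i, |quadBump y ^ 3 * (6⁻¹ * (e * spacePartial (spacePartial u) z (b i) (b i)))|
        ≤ e * ‖spacePartial (spacePartial u) z‖ := by
      intro i
      rw [abs_mul, abs_mul, abs_mul, abs_of_nonneg (pow_nonneg hQ0 3), abs_of_nonneg he0]
      calc _ ≤ 1 * (1 * (e * ‖spacePartial (spacePartial u) z‖)) := by
            gcongr
            · exact pow_le_one₀ hQ0 hQ1
            · norm_num [abs_of_pos]
            · exact hH i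
        _ = _ := by ring
    have h3 := (Finset.abs_sum_le_sum_abs (fun i => quadBump y ^ 3 * (6⁻¹ * (e *
      spacePartial (spacePartial u) z (b i) (b i)))) Finset.univ).trans
      (Finset.sum_le_sum fun i _ => h2 i)
    rw [Finset.sum_const, Finset.card_univ, Fintype.card_fin, nsmul_eq_mul] at h3
    refine (abs_add_le _ _).trans ((add_le_add h1 h3).trans ?_)
    rw [show (2 : ℝ) - 1 = 1 by norm_num, Real.rpow_one]
    have := mul_nonneg he0 (mul_nonneg (Nat.cast_nonneg (α := ℝ) (Module.finrank ℝ E))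
      (abs_nonneg (timePartial u z)))
    have := mul_nonneg he0 (norm_nonneg (spacePartial (spacePartial u) z))
    nlinarith

theorem enorm_trace_one_le (hu : ContDiff ℝ 2 u) (x : E) :
    ‖∫ y : E, quadBump y ^ 2 ∂μ‖ₑ * ‖spacePartial u (0, x)‖ₑ
      ≤ cylMean μ (fun z => ‖spacePartial u z‖ₑ) 1 x +
        cylPotential μ 1 (fun z => ENNReal.ofReal 8 * topOrder u z) x := by
  have hP : ContDiff ℝ 1 (spacePartial u) := contDiff_spacePartial hu
  have key : ∀ v : E, ‖v‖ = 1 → ‖∫ y : E, quadBump y ^ 2 ∂μ‖ₑ * ‖spacePartial u (0, x) v‖ₑ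
      ≤ cylMean μ (fun z => ‖spacePartial u z‖ₑ) 1 x +
        cylPotential μ 1 (fun z => ENNReal.ofReal 8 * topOrder u z) x := by
    intro v hv
    refine enorm_trace_le μ (G := fun z => spacePartial u z v) (hP.clm_apply contDiff_const)
      ((measurable_topOrder hu).const_mul _) hP.continuous.enorm.measurable (fun z => ?_) ?_ x
    · refine ((spacePartial u z).le_opENorm v).trans_eq ?_
      rw [← ofReal_norm v, hv, ENNReal.ofReal_one, mul_one]
    intro e he s hs x
    rw [integral_quadBump_mul_fderiv_spacePartial_eq μ hu, sub_self, Real.rpow_zero,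
      ENNReal.ofReal_one]
    refine enorm_integral_le_ball μ ENNReal.one_ne_top ?_ ?_
    · intro y hy; simp [quadBump_eq_zero hy]
    intro y hy
    have hy1 : ‖y‖ ≤ 1 := (mem_ball_zero_iff.1 hy).le
    have hs0 := hs.1.le
    rw [one_mul]
    refine enorm_le_mul_topOrder (by norm_num) ?_
    set z := (e ^ 2 * s, x + e • y)
    have hQ0 := quadBump_nonneg y
    have hQ1 := quadBump_le_one y
    have hi : |inner ℝ y v| ≤ 1 := by
      refine (abs_real_inner_le_norm y v).trans ?_
      rw [hv, mul_one]; exact hy1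
    have hH : |spacePartial (spacePartial u) z y v| ≤ ‖spacePartial (spacePartial u) z‖ := by
      refine ((spacePartial (spacePartial u) z).le_opNorm₂ y v).trans ?_
      rw [hv, mul_one]
      exact mul_le_of_le_one_right (ContinuousLinearMap.opNorm_nonneg _) hy1
    have h1 : |quadBump y ^ 1 * (8 * s * inner ℝ y v * timePartial u z)|
        ≤ 8 * |timePartial u z| := by
      rw [abs_mul, abs_mul, abs_mul, abs_of_nonneg (pow_nonneg hQ0 1),
        abs_of_nonneg (by positivity : 0 ≤ 8 * s)]
      calc _ ≤ 1 * (8 * 1 * 1 * |timePartial u z|) := by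
            gcongr
            · exact pow_le_one₀ hQ0 hQ1
            · exact hs.2.le
        _ = _ := by ring
    have h2 : |quadBump y ^ 2 * spacePartial (spacePartial u) z y v|
        ≤ ‖spacePartial (spacePartial u) z‖ := by
      rw [abs_mul, abs_of_nonneg (sq_nonneg _)]
      exact (mul_le_of_le_one_left (abs_nonneg _) (pow_le_one₀ hQ0 hQ1)).trans hH
    refine (abs_add_le _ _).trans ((add_le_add h1 h2).trans ?_)
    have := norm_nonneg (spacePartial (spacePartial u) z)
    linarith
  generalize cylMean μ (fun z => ‖spacePartial u z‖ₑ) 1 x +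
    cylPotential μ 1 (fun z => ENNReal.ofReal 8 * topOrder u z) x = R at key ⊢
  by_cases hR : R = ∞
  · simp [hR]
  rw [← enorm_smul, ← ofReal_norm, ENNReal.ofReal_le_iff_le_toReal hR]
  refine ContinuousLinearMap.opNorm_le_of_unit_norm ENNReal.toReal_nonneg fun v hv => ?_
  rw [← ENNReal.ofReal_le_iff_le_toReal hR, ofReal_norm, smul_apply, enorm_smul]
  exact key v hv

end TraceBounds

theorem cylPotential_const_mul {E : Type*} [NormedAddCommGroup E] [NormedSpace ℝ E]
    [MeasurableSpace E] (μ : Measure E) {f : ℝ × E → ℝ≥0∞} (a : ℝ) {c : ℝ≥0∞} (hc : c ≠ ∞) (x : E) :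
    cylPotential μ a (fun z => c * f z) x = c * cylPotential μ a f x := by
  simp only [cylPotential, cylMean, lintegral_const_mul' c _ hc, mul_left_comm _ c]

section Linearity

variable {E : Type*} [NormedAddCommGroup E] [NormedSpace ℝ E] [MeasurableSpace E] [BorelSpace E]
  [FiniteDimensional ℝ E] (μ : Measure E) [μ.IsAddHaarMeasure] {f g : ℝ × E → ℝ≥0∞}

theorem cylMean_add (hf : Measurable f) (e : ℝ) (x : E) :
    cylMean μ (fun z => f z + g z) e x = cylMean μ f e x + cylMean μ g e x := by
  have hm : Measurable fun s : ℝ => ∫⁻ y in ball (0 : E) 1, f (e ^ 2 * s, x + e • y) ∂μ :=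
    (measurable_ballInt μ hf).comp (g := fun w : ℝ × ℝ × E =>
      ∫⁻ y in ball (0 : E) 1, f (w.1 ^ 2 * w.2.1, w.2.2 + w.1 • y) ∂μ)
      (measurable_const.prodMk (measurable_id.prodMk measurable_const))
  simp only [cylMean]
  rw [← lintegral_add_left hm]
  refine lintegral_congr fun s => lintegral_add_left (hf.comp ?_) _
  fun_prop

theorem cylPotential_add (a : ℝ) (hf : Measurable f) (x : E) :
    cylPotential μ a (fun z => f z + g z) x = cylPotential μ a f x + cylPotential μ a g x := by
  have hm : Measurable fun e : ℝ => ENNReal.ofReal (e ^ (a - 1)) * cylMean μ f e x :=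
    Measurable.mul (by fun_prop)
      ((measurable_cylMean μ hf).comp (measurable_id.prodMk measurable_const))
  simp only [cylPotential, cylMean_add μ hf, mul_add]
  exact lintegral_add_left hm _

end Linearity

theorem lintegral_const_mul_rpow {α : Type*} [MeasurableSpace α] {ν : Measure α} {r : ℝ}
    (hr : 0 < r) {c : ℝ≥0∞} (hc : c ≠ ∞) (g : α → ℝ≥0∞) :
    (∫⁻ x, (c * g x) ^ r ∂ν) ^ (1 / r) = c * (∫⁻ x, g x ^ r ∂ν) ^ (1 / r) := by
  simp only [ENNReal.mul_rpow_of_nonneg _ _ hr.le]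
  rw [lintegral_const_mul' _ _ (ENNReal.rpow_ne_top_of_nonneg hr.le hc),
    ENNReal.mul_rpow_of_nonneg _ _ (by positivity), ← ENNReal.rpow_mul,
    mul_one_div_cancel hr.ne', ENNReal.rpow_one]

section Bounds

variable {E : Type*} [NormedAddCommGroup E] [NormedSpace ℝ E] [MeasurableSpace E] [BorelSpace E]
  [FiniteDimensional ℝ E] (μ : Measure E) [μ.IsAddHaarMeasure] {p q r a β : ℝ}

theorem exists_bound_of_le_cylPotential (hp : 1 ≤ p) (hq : 1 ≤ q) (hr : p ≤ r) (hβ : a < β)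
    (hκ : 0 < a + Module.finrank ℝ E / r - Module.finrank ℝ E / p - 2 / q)
    {c c' : ℝ≥0∞} (hc : c ≠ 0) (hc1 : c ≠ ∞) (hc' : c' ≠ ∞) :
    ∃ C : ℝ≥0∞, C ≠ ∞ ∧ ∀ (h : E → ℝ≥0∞) (w f₁ f₂ : ℝ × E → ℝ≥0∞) (K : ℝ≥0∞),
      Measurable w → Measurable f₁ → Measurable f₂ → MorreyBound μ p q β w K →
      MorreyBound μ p q β f₁ K → MorreyBound μ p q β f₂ K →
      (∀ x, c * h x ≤ cylMean μ w 1 x + cylPotential μ a (fun z => c' * (f₁ z + f₂ z)) x) →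
      ∀ ρ ∈ Ioc (0 : ℝ) (1 / 2), ∀ x₀ : E,
      (∫⁻ x in ball x₀ ρ, h x ^ r ∂μ) ^ (1 / r)
        ≤ C * (ENNReal.ofReal (ρ ^ (a + Module.finrank ℝ E / r - β)) * K) := by
  have hp0 : 0 < p := by linarith
  have hr0 : 0 < r := by linarith
  have hp1 : 0 ≤ 1 - 1 / p := by rw [sub_nonneg, div_le_one hp0]; exact hp
  obtain ⟨C, hC, hbd⟩ := exists_cylPotential_bound (E := E) μ hp hq hr hβ hκ
  set V := μ (ball (0 : E) 1)
  have hV : V ≠ ∞ := measure_ball_lt_top.ne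
  have hVp := ENNReal.rpow_ne_top_of_nonneg hp1 hV
  have hVr := ENNReal.rpow_ne_top_of_nonneg (by positivity : 0 ≤ 1 / r) hV
  have hci : c⁻¹ ≠ ∞ := ENNReal.inv_ne_top.2 hc
  refine ⟨c⁻¹ * (V ^ (1 - 1 / p) * V ^ (1 / r) + c' * (C + C)), by finiteness, ?_⟩
  intro h w f₁ f₂ K hw hf₁ hf₂ hwK h₁K h₂K hle ρ hρ x₀
  set X := ENNReal.ofReal (ρ ^ (a + Module.finrank ℝ E / r - β)) * K
  have hpt : ∀ x, h x ≤ c⁻¹ * (V ^ (1 - 1 / p) * K +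
      c' * (cylPotential μ a f₁ x + cylPotential μ a f₂ x)) := by
    intro x
    rw [← ENNReal.inv_mul_cancel_left (b := h x) hc hc1]
    refine mul_le_mul' le_rfl ((hle x).trans (add_le_add ?_ ?_))
    · simpa using hwK.cylMean_le μ hp hq hw (e := 1) ⟨one_pos, le_rfl⟩ x
    · rw [cylPotential_const_mul μ a hc', cylPotential_add μ a hf₁]
  calc _ ≤ (∫⁻ x in ball x₀ ρ, (c⁻¹ * (V ^ (1 - 1 / p) * K +
          c' * (cylPotential μ a f₁ x + cylPotential μ a f₂ x))) ^ r ∂μ) ^ (1 / r) := by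
        gcongr with x
        exact hpt x
    _ = c⁻¹ * (∫⁻ x in ball x₀ ρ, (V ^ (1 - 1 / p) * K +
          c' * (cylPotential μ a f₁ x + cylPotential μ a f₂ x)) ^ r ∂μ) ^ (1 / r) :=
        lintegral_const_mul_rpow hr0 hci _
    _ ≤ c⁻¹ * ((∫⁻ x in ball x₀ ρ, (V ^ (1 - 1 / p) * K) ^ r ∂μ) ^ (1 / r) +
          (∫⁻ x in ball x₀ ρ,
            (c' * (cylPotential μ a f₁ x + cylPotential μ a f₂ x)) ^ r ∂μ) ^ (1 / r)) := by
        refine mul_le_mul' le_rfl ?_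
        exact ENNReal.lintegral_Lp_add_le (f := fun _ => V ^ (1 - 1 / p) * K) (g := fun x =>
          c' * (cylPotential μ a f₁ x + cylPotential μ a f₂ x)) aemeasurable_const
          (((measurable_cylPotential μ a hf₁).add
            (measurable_cylPotential μ a hf₂)).const_mul c').aemeasurable (hp.trans hr)
    _ ≤ c⁻¹ * (V ^ (1 - 1 / p) * V ^ (1 / r) * X + c' * (C * X + C * X)) := by
        refine mul_le_mul' le_rfl (add_le_add ?_ ?_)
        · rw [lintegral_rpow_const_ball μ hr0 hρ.1]
          calc _ = V ^ (1 - 1 / p) * V ^ (1 / r) *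
                (ENNReal.ofReal (ρ ^ (Module.finrank ℝ E / r : ℝ)) * K) := by ring
            _ ≤ _ := by
              refine mul_le_mul' le_rfl (mul_le_mul' (ENNReal.ofReal_le_ofReal ?_) le_rfl)
              exact Real.rpow_le_rpow_of_exponent_ge hρ.1 (by linarith [hρ.2]) (by linarith)
        · rw [lintegral_const_mul_rpow hr0 hc']
          refine mul_le_mul' le_rfl ((ENNReal.lintegral_Lp_add_le
            (measurable_cylPotential μ a hf₁).aemeasurable
            (measurable_cylPotential μ a hf₂).aemeasurable (hp.trans hr)).trans ?_)
          exact add_le_add (hbd f₁ K hf₁ h₁K ρ hρ x₀) (hbd f₂ K hf₂ h₂K ρ hρ x₀)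
    _ = _ := by ring

end Bounds

/-- A scale-invariant bound on balls of radius at most `1 / 2` extends to radius `1`. -/
theorem exists_bound_of_small_balls {E : Type*} [NormedAddCommGroup E] [NormedSpace ℝ E]
    [FiniteDimensional ℝ E] [MeasurableSpace E] [BorelSpace E] (μ : Measure E) {r : ℝ}
    (hr : 0 < r) (κ : ℝ) :
    ∃ C : ℝ≥0∞, C ≠ ∞ ∧ ∀ (h : E → ℝ≥0∞) (K : ℝ≥0∞),
      (∀ ρ ∈ Ioc (0 : ℝ) (1 / 2), ∀ x₀ : E,
        (∫⁻ x in ball x₀ ρ, h x ^ r ∂μ) ^ (1 / r) ≤ ENNReal.ofReal (ρ ^ κ) * K) →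
      ∀ ρ ∈ Ioc (0 : ℝ) 1, ∀ x₀ : E,
        (∫⁻ x in ball x₀ ρ, h x ^ r ∂μ) ^ (1 / r) ≤ C * (ENNReal.ofReal (ρ ^ κ) * K) := by
  obtain ⟨t, -, htf, htc⟩ := (isCompact_closedBall (0 : E) 1).finite_cover_balls
    (e := 1 / 2) (by norm_num)
  obtain ⟨t, rfl⟩ := htf.exists_finset_coe
  have hm : ((t.card : ℝ≥0∞) ^ (1 / r)) ≠ ∞ :=
    ENNReal.rpow_ne_top_of_nonneg (by positivity) (ENNReal.natCast_ne_top _)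
  refine ⟨1 + t.card ^ (1 / r) * ENNReal.ofReal (2 ^ |κ|), by finiteness, ?_⟩
  intro h K hK ρ hρ x₀
  rcases le_or_gt ρ (1 / 2) with hρ2 | hρ2
  · refine (hK ρ ⟨hρ.1, hρ2⟩ x₀).trans (le_mul_of_one_le_left' le_self_add)
  have hhalf : ENNReal.ofReal ((1 / 2) ^ κ)
      ≤ ENNReal.ofReal (2 ^ |κ|) * ENNReal.ofReal (ρ ^ κ) := by
    rw [← ENNReal.ofReal_mul (by positivity)]
    refine ENNReal.ofReal_le_ofReal ?_
    rcases le_or_gt 0 κ with hκ | hκ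
    · rw [abs_of_nonneg hκ]
      exact (Real.rpow_le_rpow (by norm_num) hρ2.le hκ).trans (le_mul_of_one_le_left
        (Real.rpow_nonneg hρ.1.le _) (Real.one_le_rpow (by norm_num) hκ))
    · rw [abs_of_neg hκ, one_div, Real.inv_rpow zero_le_two, ← Real.rpow_neg zero_le_two]
      exact le_mul_of_one_le_right (by positivity)
        (Real.one_le_rpow_of_pos_of_le_one_of_nonpos hρ.1 hρ.2 hκ.le)
  have hcov : ball x₀ ρ ⊆ ⋃ i ∈ t, ball (x₀ + i) (1 / 2) := by
    intro y hy
    have : y - x₀ ∈ closedBall (0 : E) 1 := by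
      rw [mem_closedBall_zero_iff, ← dist_eq_norm]
      exact (mem_ball.1 hy).le.trans hρ.2
    obtain ⟨i, hi, hyi⟩ := mem_iUnion₂.1 (htc this)
    refine mem_iUnion₂.2 ⟨i, hi, ?_⟩
    rw [mem_ball, dist_eq_norm] at hyi ⊢
    rwa [← sub_sub]
  have hone : ∀ i, ∫⁻ x in ball (x₀ + i) (1 / 2), h x ^ r ∂μ
      ≤ (ENNReal.ofReal ((1 / 2) ^ κ) * K) ^ r := fun i => by
    have := hK (1 / 2) ⟨by norm_num, le_rfl⟩ (x₀ + i)
    rwa [one_div r, ENNReal.rpow_inv_le_iff hr] at this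
  calc _ ≤ (∑ i ∈ t, ∫⁻ x in ball (x₀ + i) (1 / 2), h x ^ r ∂μ) ^ (1 / r) := by
        gcongr
        simp only [← withDensity_apply _ measurableSet_ball]
        exact (measure_mono hcov).trans (measure_biUnion_finset_le _ _)
    _ ≤ (t.card * (ENNReal.ofReal ((1 / 2) ^ κ) * K) ^ r) ^ (1 / r) := by
        gcongr
        refine (Finset.sum_le_sum fun i _ => hone i).trans ?_
        rw [Finset.sum_const, nsmul_eq_mul]
    _ = t.card ^ (1 / r) * (ENNReal.ofReal ((1 / 2) ^ κ) * K) := by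
        rw [ENNReal.mul_rpow_of_nonneg _ _ (by positivity), ← ENNReal.rpow_mul,
          mul_one_div_cancel hr.ne', ENNReal.rpow_one]
    _ ≤ t.card ^ (1 / r) * (ENNReal.ofReal (2 ^ |κ|) * ENNReal.ofReal (ρ ^ κ) * K) := by
        gcongr
    _ = (t.card ^ (1 / r) * ENNReal.ofReal (2 ^ |κ|)) * (ENNReal.ofReal (ρ ^ κ) * K) := by ring
    _ ≤ _ := by gcongr; exact le_add_self

section MorreyNorms

variable {d : ℕ} {p q r β : ℝ}

local notation "X" => EuclideanSpace ℝ (Fin d)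

theorem mixedNorm_indicator_cyl (hp : 0 < p) (hq : 0 < q) (g : ℝ × X → ℝ) (ρ : ℝ)
    (z : ℝ × X) :
    mixedNorm d p q ((cyl d ρ z).indicator g) = cylNorm volume p q (fun z => ‖g z‖ₑ) ρ z := by
  rw [mixedNorm, cylNorm, ← lintegral_indicator measurableSet_Ico]
  congr 1
  refine lintegral_congr fun t => ?_
  by_cases ht : t ∈ Ico z.1 (z.1 + ρ ^ 2)
  · rw [indicator_of_mem ht, ← lintegral_indicator measurableSet_ball]
    congr 1
    refine lintegral_congr fun x => ?_
    by_cases hx : x ∈ ball z.2 ρ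
    · rw [indicator_of_mem hx, indicator_of_mem (show (t, x) ∈ cyl d ρ z from ⟨ht, hx⟩),
        Real.enorm_eq_ofReal_abs]
    · rw [indicator_of_notMem hx,
        indicator_of_notMem (show (t, x) ∉ cyl d ρ z from fun h => hx h.2)]
      simp [hp]
  · rw [indicator_of_notMem ht]
    have hn : ∀ x, (cyl d ρ z).indicator g (t, x) = 0 := fun x =>
      indicator_of_notMem (fun h => ht h.1) g
    simp [hn, hp, div_pos hq hp]

theorem mixedNorm_indicator_one (hp : 0 < p) (hq : 0 < q) {ρ : ℝ} (hρ : 0 < ρ) (z : ℝ × X) :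
    mixedNorm d p q ((cyl d ρ z).indicator fun _ => (1 : ℝ))
      = ENNReal.ofReal (ρ ^ (d / p + 2 / q)) * volume (ball (0 : X) 1) ^ (1 / p) := by
  rw [mixedNorm_indicator_cyl hp hq, cylNorm]
  simp only [enorm_one, ENNReal.one_rpow, setLIntegral_one]
  rw [setLIntegral_const, Real.volume_Ico, Measure.addHaar_ball_of_pos _ _ hρ,
    finrank_euclideanSpace, Fintype.card_fin, add_sub_cancel_left, ENNReal.mul_rpow_of_nonneg _ _ (by positivity),
    ENNReal.mul_rpow_of_nonneg _ _ (by positivity : 0 ≤ q / p),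
    ENNReal.mul_rpow_of_nonneg _ _ (by positivity : 0 ≤ 1 / q), ← ENNReal.rpow_mul,
    ← ENNReal.rpow_mul, show q / p * (1 / q) = 1 / p by field_simp,
    ENNReal.ofReal_rpow_of_pos (by positivity), ENNReal.ofReal_rpow_of_pos (by positivity),
    mul_right_comm, ← ENNReal.ofReal_mul (by positivity), ← Real.rpow_natCast ρ d,
    ← Real.rpow_natCast ρ 2, ← Real.rpow_mul hρ.le, ← Real.rpow_mul hρ.le, ← Real.rpow_add hρ]
  congr 3
  push_cast
  ring

theorem morreyBound_pMorrey (hp : 0 < p) (hq : 0 < q) (g : ℝ × X → ℝ) :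
    MorreyBound (volume : Measure X) p q β (fun z => ‖g z‖ₑ)
      (volume (ball (0 : X) 1) ^ (1 / p) * pMorrey d (Ioc 0 1) p q β g) := by
  intro ρ hρ z
  have h : ENNReal.ofReal (ρ ^ β) * mixedNorm d p q ((cyl d ρ z).indicator g) /
      mixedNorm d p q ((cyl d ρ z).indicator fun _ => (1 : ℝ)) ≤ pMorrey d (Ioc 0 1) p q β g :=
    le_iSup₂_of_le ρ hρ (le_iSup (fun z => ENNReal.ofReal (ρ ^ β) *
      mixedNorm d p q ((cyl d ρ z).indicator g) /
      mixedNorm d p q ((cyl d ρ z).indicator fun _ => (1 : ℝ))) z)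
  have hV0 : volume (ball (0 : X) 1) ≠ 0 := (measure_ball_pos _ _ one_pos).ne'
  have hV : volume (ball (0 : X) 1) ≠ ∞ := measure_ball_lt_top.ne
  have hVp0 := (ENNReal.rpow_pos (p := 1 / p) (pos_iff_ne_zero.2 hV0) hV).ne'
  have hVp := ENNReal.rpow_ne_top_of_nonneg (by positivity : 0 ≤ 1 / p) hV
  have hρβ : 0 < ρ ^ β := Real.rpow_pos_of_pos hρ.1 _
  have hρd : 0 < ρ ^ (d / p + 2 / q) := Real.rpow_pos_of_pos hρ.1 _
  rw [mixedNorm_indicator_one hp hq hρ.1, mixedNorm_indicator_cyl hp hq, ENNReal.div_le_iff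
    (mul_ne_zero (ENNReal.ofReal_pos.2 hρd).ne' hVp0)
    (ENNReal.mul_ne_top ENNReal.ofReal_ne_top hVp),
    mul_comm, ← ENNReal.le_div_iff_mul_le (Or.inl (ENNReal.ofReal_pos.2 hρβ).ne')
      (Or.inl ENNReal.ofReal_ne_top)] at h
  refine h.trans_eq ?_
  rw [finrank_euclideanSpace, Fintype.card_fin, Real.rpow_sub hρ.1, ENNReal.ofReal_div_of_pos hρβ,
    ENNReal.div_eq_inv_mul, ENNReal.div_eq_inv_mul]
  ring

theorem MorreyBound.mono {f : ℝ × X → ℝ≥0∞} {K K' : ℝ≥0∞}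
    (h : MorreyBound (volume : Measure X) p q β f K) (hK : K ≤ K') :
    MorreyBound (volume : Measure X) p q β f K' :=
  fun ρ hρ z => (h ρ hρ z).trans (mul_le_mul' le_rfl hK)

theorem ofReal_rpow_mul_average_eq (hr : 0 < r) {g : X → ℝ} (hg : Continuous g) {b ρ : ℝ}
    (hρ : 0 < ρ) (x : X) :
    ENNReal.ofReal (ρ ^ b * (⨍ y in ball x ρ, |g y| ^ r) ^ (1 / r))
      = ENNReal.ofReal (ρ ^ (b - d / r)) * (volume (ball (0 : X) 1) ^ (1 / r))⁻¹ *
        (∫⁻ y in ball x ρ, ‖g y‖ₑ ^ r) ^ (1 / r) := by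
  have hc : Continuous fun y => |g y| ^ r := hg.abs.rpow_const fun _ => Or.inr hr.le
  have hi : IntegrableOn (fun y => |g y| ^ r) (ball x ρ) :=
    (hc.continuousOn.integrableOn_compact (isCompact_closedBall x ρ)).mono_set
      ball_subset_closedBall
  have hI : ENNReal.ofReal (∫ y in ball x ρ, |g y| ^ r) = ∫⁻ y in ball x ρ, ‖g y‖ₑ ^ r := by
    rw [ofReal_integral_eq_lintegral_ofReal hi (.of_forall fun y => by positivity)]
    refine lintegral_congr fun y => ?_
    rw [Real.enorm_eq_ofReal_abs, ENNReal.ofReal_rpow_of_nonneg (abs_nonneg _) hr.le]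
  have hI0 : 0 ≤ ∫ y in ball x ρ, |g y| ^ r := integral_nonneg fun y => by positivity
  rw [setAverage_eq, smul_eq_mul, Real.mul_rpow (by positivity) hI0,
    ENNReal.ofReal_mul (by positivity), ENNReal.ofReal_mul (by positivity),
    ← ENNReal.ofReal_rpow_of_nonneg hI0 (by positivity), hI, Real.inv_rpow (by positivity),
    ← mul_assoc]
  congr 1
  have hV0 : 0 < volume (ball (0 : X) 1) := measure_ball_pos _ _ one_pos
  have hV : volume (ball (0 : X) 1) ≠ ∞ := measure_ball_lt_top.ne
  have hreal : volume.real (ball x ρ) = ρ ^ d * volume.real (ball (0 : X) 1) := by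
    rw [measureReal_def, Measure.addHaar_ball_of_pos _ _ hρ, finrank_euclideanSpace,
      Fintype.card_fin, ENNReal.toReal_mul, ENNReal.toReal_ofReal (by positivity), measureReal_def]
  have hVr : 0 < volume.real (ball (0 : X) 1) := ENNReal.toReal_pos hV0.ne' hV
  rw [hreal, Real.mul_rpow (by positivity) (by positivity), mul_inv,
    ENNReal.ofReal_mul (by positivity), ← mul_assoc, ← ENNReal.ofReal_mul (by positivity),
    ENNReal.ofReal_inv_of_pos (Real.rpow_pos_of_pos hVr _),
    ← ENNReal.ofReal_rpow_of_pos hVr, measureReal_def, ENNReal.ofReal_toReal hV,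
    ← Real.rpow_natCast, ← Real.rpow_mul hρ.le, ← Real.rpow_neg hρ.le, ← Real.rpow_add hρ]
  congr 3
  ring

theorem timeDeriv_eq {u : ℝ × X → ℝ} (hu : ContDiff ℝ 1 u) : timeDeriv d u = timePartial u := by
  ext z
  have h : HasDerivAt (fun s : ℝ => (s, z.2)) ((1 : ℝ), (0 : X)) z.1 :=
    (hasDerivAt_id z.1).prodMk (hasDerivAt_const z.1 z.2)
  exact ((hu.differentiable (by norm_num) z).hasFDerivAt.comp_hasDerivAt z.1 h).deriv

theorem fderiv_slice_eq {F : Type*} [NormedAddCommGroup F] [NormedSpace ℝ F] {u : ℝ × X → F}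
    (hu : ContDiff ℝ 1 u) (t : ℝ) (x : X) :
    fderiv ℝ (fun y => u (t, y)) x = spacePartial u (t, x) := by
  simpa using (hasFDerivAt_slice hu t 1 0 x).fderiv

theorem spaceGradNorm_eq {u : ℝ × X → ℝ} (hu : ContDiff ℝ 1 u) :
    spaceGradNorm d u = fun z => ‖spacePartial u z‖ := by
  ext z; rw [spaceGradNorm, fderiv_slice_eq hu]

theorem spaceHessNorm_eq {u : ℝ × X → ℝ} (hu : ContDiff ℝ 2 u) :
    spaceHessNorm d u = fun z => ‖spacePartial (spacePartial u) z‖ := by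
  ext z
  simp only [spaceHessNorm, fderiv_slice_eq (hu.of_le (by norm_num : (1 : WithTop ℕ∞) ≤ 2))]
  rw [fderiv_slice_eq (contDiff_spacePartial (m := 1) hu)]

theorem exists_morreyNormOn_le {a : ℝ} (hp : 1 ≤ p) (hq : 1 ≤ q) (hr : p ≤ r) (hβ : a < β)
    (hκ : 0 < a + d / r - d / p - 2 / q) {c c' : ℝ≥0∞} (hc : c ≠ 0) (hc1 : c ≠ ∞) (hc' : c' ≠ ∞) :
    ∃ N : ℝ, 0 < N ∧ ∀ (g : X → ℝ) (w f₁ f₂ : ℝ × X → ℝ) (S : ℝ≥0∞), Continuous g →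
      Continuous w → Continuous f₁ → Continuous f₂ → pMorrey d (Ioc 0 1) p q β w ≤ S →
      pMorrey d (Ioc 0 1) p q β f₁ ≤ S → pMorrey d (Ioc 0 1) p q β f₂ ≤ S →
      (∀ x, c * ‖g x‖ₑ ≤ cylMean volume (fun z => ‖w z‖ₑ) 1 x +
        cylPotential volume a (fun z => c' * (‖f₁ z‖ₑ + ‖f₂ z‖ₑ)) x) →
      morreyNormOn d (Ioc 0 1) r (β - a) g ≤ ENNReal.ofReal N * S := by
  have hp0 : 0 < p := by linarith
  have hq0 : 0 < q := by linarith
  have hr0 : 0 < r := by linarith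
  obtain ⟨C₁, hC₁, h₁⟩ := exists_bound_of_le_cylPotential (E := X) volume hp hq hr hβ
    (by simpa using hκ) hc hc1 hc'
  obtain ⟨C₂, hC₂, h₂⟩ := exists_bound_of_small_balls (E := X) volume hr0 (a + d / r - β)
  set V := volume (ball (0 : X) 1)
  have hV0 : V ≠ 0 := (measure_ball_pos _ _ one_pos).ne'
  have hV : V ≠ ∞ := measure_ball_lt_top.ne
  have hVp : V ^ (1 / p) ≠ ∞ := ENNReal.rpow_ne_top_of_nonneg (by positivity) hV
  have hVr : (V ^ (1 / r))⁻¹ ≠ ∞ :=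
    ENNReal.inv_ne_top.2 (ENNReal.rpow_pos (pos_iff_ne_zero.2 hV0) hV).ne'
  set M : ℝ≥0∞ := (V ^ (1 / r))⁻¹ * C₂ * C₁ * V ^ (1 / p)
  have hM : M ≠ ∞ := by finiteness
  refine ⟨M.toReal + 1, by positivity, ?_⟩
  intro g w f₁ f₂ S hg hw hf₁ hf₂ hwS h₁S h₂S hle
  have hK : ∀ f : ℝ × X → ℝ, pMorrey d (Ioc 0 1) p q β f ≤ S →
      MorreyBound (volume : Measure X) p q β (fun z => ‖f z‖ₑ) (V ^ (1 / p) * S) := fun f hf =>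
    (morreyBound_pMorrey hp0 hq0 f).mono (mul_le_mul' le_rfl hf)
  have hsmall := h₁ (fun x => ‖g x‖ₑ) _ _ _ _ hw.enorm.measurable hf₁.enorm.measurable
    hf₂.enorm.measurable (hK w hwS) (hK f₁ h₁S) (hK f₂ h₂S) hle
  simp only [finrank_euclideanSpace, Fintype.card_fin] at hsmall
  have hall := h₂ (fun x => ‖g x‖ₑ) (C₁ * (V ^ (1 / p) * S)) fun ρ hρ x₀ =>
    (hsmall ρ hρ x₀).trans_eq (mul_left_comm _ _ _)
  refine iSup₂_le fun ρ hρ => iSup_le fun x => ?_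
  rw [ofReal_rpow_mul_average_eq hr0 hg hρ.1]
  calc _ ≤ ENNReal.ofReal (ρ ^ (β - a - d / r)) * (V ^ (1 / r))⁻¹ *
        (C₂ * (ENNReal.ofReal (ρ ^ (a + d / r - β)) * (C₁ * (V ^ (1 / p) * S)))) :=
        mul_le_mul' le_rfl (hall ρ hρ x)
    _ = (ENNReal.ofReal (ρ ^ (β - a - d / r)) * ENNReal.ofReal (ρ ^ (a + d / r - β))) *
        (M * S) := by ring
    _ = M * S := by
        rw [← ENNReal.ofReal_mul (Real.rpow_nonneg hρ.1.le _), ← Real.rpow_add hρ.1,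
          show β - a - d / r + (a + d / r - β) = 0 by ring, Real.rpow_zero, ENNReal.ofReal_one,
          one_mul]
    _ ≤ _ := by
        gcongr
        exact (ENNReal.le_ofReal_iff_toReal_le hM (by positivity)).2 (by linarith)

end MorreyNorms

/-- Trace theorem for parabolic Morrey spaces (Theorem 3.1, estimate (3.3)):
`‖D^γ u(0,·)‖_{E_{r,β+γ-2}} ≤ N ‖u‖_{E^{1,2}_{p,q,β}}`. -/
theorem trace_parabolic_morrey_full (d : ℕ) (hd : 2 ≤ d) (γ : ℕ) (hγ : γ = 0 ∨ γ = 1)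
    (p q r β : ℝ) (hp : 1 < p) (hq : 1 < q) (hr : p ≤ r)
    (hβ1 : 2 - γ < β) (hβ2 : β ≤ d / p + 2 / q) (hβ3 : d / p + 2 / q < 2 - γ + d / r) :
    ∃ N : ℝ, 0 < N ∧
      ∀ u : ℝ × EuclideanSpace ℝ (Fin d) → ℝ,
        ContDiff ℝ (⊤ : ℕ∞) u →
        pMorrey d (Set.Ioc 0 1) p q β u < ∞ →
        pMorrey d (Set.Ioc 0 1) p q β (spaceGradNorm d u) < ∞ →
        pMorrey d (Set.Ioc 0 1) p q β (spaceHessNorm d u) < ∞ →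
        pMorrey d (Set.Ioc 0 1) p q β (timeDeriv d u) < ∞ →
        morreyNormOn d (Set.Ioc 0 1) r (β + γ - 2) (traceD d γ u) ≤
          ENNReal.ofReal N *
            (pMorrey d (Set.Ioc 0 1) p q β u +
              pMorrey d (Set.Ioc 0 1) p q β (spaceGradNorm d u) +
              pMorrey d (Set.Ioc 0 1) p q β (spaceHessNorm d u) +
              pMorrey d (Set.Ioc 0 1) p q β (timeDeriv d u)) := by
  have hp0 : 0 < p := by linarith
  have hr0 : 0 < r := by linarith
  set c := ‖∫ y : EuclideanSpace ℝ (Fin d), quadBump y ^ 2‖ₑ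
  have hc : c ≠ 0 := enorm_ne_zero.2 (integral_quadBump_sq_pos volume).ne'
  have hc1 : c ≠ ∞ := enorm_ne_top
  rcases hγ with rfl | rfl
  · obtain ⟨N, hN, h⟩ := exists_morreyNormOn_le (d := d) (β := β) (a := 2) hp.le hq.le hr
      (by simpa using hβ1) (by norm_num at hβ3; linarith) hc hc1
      (c' := ENNReal.ofReal (d + 2)) ENNReal.ofReal_ne_top
    refine ⟨N, hN, fun u hu _ _ _ _ => ?_⟩
    have hu2 : ContDiff ℝ 2 u := contDiff_infty.1 hu 2
    have hu1 : ContDiff ℝ 1 u := hu2.of_le (by norm_num)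
    have hP : ContDiff ℝ 1 (spacePartial u) := contDiff_spacePartial hu2
    have hH := (contDiff_spacePartial (m := 0) hP).continuous
    have htr : traceD d 0 u = fun x => u (0, x) := by
      ext x; simp [traceD]
    rw [show β + (0 : ℕ) - 2 = β - 2 by simp, htr]
    refine h _ u (timeDeriv d u) (spaceHessNorm d u) _ ?_ hu.continuous ?_ ?_
      (by simp only [add_assoc]; exact le_self_add) le_add_self
      (by rw [add_assoc]; exact le_add_self.trans' le_self_add) ?_
    · exact hu.continuous.comp (by fun_prop)
    · rw [timeDeriv_eq hu1]; exact (contDiff_timePartial hu2).continuous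
    · rw [spaceHessNorm_eq hu2]; exact hH.norm
    · intro x
      have := enorm_trace_zero_le volume hu2 x
      rw [timeDeriv_eq hu1, spaceHessNorm_eq hu2]
      simpa [topOrder] using this
  · obtain ⟨N, hN, h⟩ := exists_morreyNormOn_le (d := d) (β := β) (a := 1) hp.le hq.le hr
      (by norm_num at hβ1; linarith) (by norm_num at hβ3; linarith) hc hc1
      (c' := ENNReal.ofReal 8) ENNReal.ofReal_ne_top
    refine ⟨N, hN, fun u hu _ _ _ _ => ?_⟩
    have hu2 : ContDiff ℝ 2 u := contDiff_infty.1 hu 2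
    have hu1 : ContDiff ℝ 1 u := hu2.of_le (by norm_num)
    have hP : ContDiff ℝ 1 (spacePartial u) := contDiff_spacePartial hu2
    have hH := (contDiff_spacePartial (m := 0) hP).continuous
    have htr : traceD d 1 u = fun x => ‖spacePartial u (0, x)‖ := by
      ext x; simp only [traceD, if_true, fderiv_slice_eq hu1]
    rw [show β + (1 : ℕ) - 2 = β - 1 by push_cast; ring, htr]
    refine h _ (spaceGradNorm d u) (timeDeriv d u) (spaceHessNorm d u) _ ?_ ?_ ?_ ?_
      (by rw [add_assoc, add_assoc]; exact le_add_self.trans' le_self_add) le_add_self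
      (by rw [add_assoc]; exact le_add_self.trans' le_self_add) ?_
    · exact (hP.continuous.comp (by fun_prop)).norm
    · rw [spaceGradNorm_eq hu1]; exact hP.continuous.norm
    · rw [timeDeriv_eq hu1]; exact (contDiff_timePartial hu2).continuous
    · rw [spaceHessNorm_eq hu2]; exact hH.norm
    · intro x
      have := enorm_trace_one_le volume hu2 x
      rw [timeDeriv_eq hu1, spaceHessNorm_eq hu2, spaceGradNorm_eq hu1]
      simpa [topOrder] using this
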